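/- Let σ be a distortion function and p ∈ (1,∞). Then the Banach space L_σ^p(P) is reflexive. -/

import Mathlib

open MeasureTheory
open scoped ENNReal NNReal

noncomputable section

variable {Ω : Type*} [MeasurableSpace Ω]

/-- A `[0,1]`-valued random variable uniformly distributed on `[0,1]`:
`P(U ≤ u) = u` for all `u ∈ [0,1]`. -/
def IsUniformRV (P : Measure Ω) (U : Ω → ℝ) : Prop :=
  Measurable U ∧ (∀ ω, U ω ∈ Set.Icc (0 : ℝ) 1) ∧
    ∀ u ∈ Set.Icc (0 : ℝ) 1, P {ω | U ω ≤ u} = ENNReal.ofReal u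

/-- A distortion function: nondecreasing, nonnegative, left-continuous on `[0,1)`
with `∫₀¹ σ(u) du = 1`. -/
structure IsDistortion (σ : ℝ → ℝ) : Prop where
  nonneg : ∀ u ∈ Set.Ico (0 : ℝ) 1, 0 ≤ σ u
  mono : MonotoneOn σ (Set.Ico (0 : ℝ) 1)
  left_continuous : ∀ u ∈ Set.Ioo (0 : ℝ) 1,
    Filter.Tendsto σ (nhdsWithin u (Set.Iio u)) (nhds (σ u))
  integral_one : ∫ u in Set.Ioo (0 : ℝ) 1, σ u = 1

/-- `‖Y‖_{σ,p}^p := sup over uniform U of E[σ(U)·‖Y‖^p]`. -/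
def sigmaPow (P : Measure Ω) (σ : ℝ → ℝ) (p : ℝ) {X : Type*} [NormedAddCommGroup X]
    (Y : Ω → X) : ℝ≥0∞ :=
  ⨆ (U : Ω → ℝ) (_ : IsUniformRV P U),
    ∫⁻ ω, ENNReal.ofReal (σ (U ω)) * (‖Y ω‖₊ : ℝ≥0∞) ^ p ∂P

/-- The norm `‖Y‖_{σ,p}`. -/
def sigmaNorm (P : Measure Ω) (σ : ℝ → ℝ) (p : ℝ) {X : Type*} [NormedAddCommGroup X]
    (Y : Ω → X) : ℝ≥0∞ :=
  sigmaPow P σ p Y ^ (1 / p)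

/-- Membership in `L_σ^p(P,X)`: strongly measurable with finite `σ,p`-norm. -/
def MemLsigma (P : Measure Ω) (σ : ℝ → ℝ) (p : ℝ) {X : Type*} [NormedAddCommGroup X]
    (Y : Ω → X) : Prop :=
  AEStronglyMeasurable Y P ∧ sigmaPow P σ p Y < ∞

/-- The generalized inverse distribution function (quantile function)
`F_g^{-1}(α) = inf {q : P(g ≤ q) ≥ α}`. -/
def quantileFn (P : Measure Ω) (g : Ω → ℝ) (α : ℝ) : ℝ :=
  sInf {q : ℝ | ENNReal.ofReal α ≤ P {ω | g ω ≤ q}}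

variable {𝕂 : Type*} [RCLike 𝕂]

/-- The Köthe dual of `L_σ^p(P)`:
`{Z measurable : Z·Y ∈ L¹(P) for all Y ∈ L_σ^p(P)}`. -/
def KoetheDual (P : Measure Ω) (σ : ℝ → ℝ) (p : ℝ) (Z : Ω → 𝕂) : Prop :=
  AEStronglyMeasurable Z P ∧
    ∀ Y : Ω → 𝕂, MemLsigma P σ p Y → Integrable (fun ω => Z ω * Y ω) P

/-- The average value-at-risk of level `α` of the (nonnegative) random variable `g`:
`AV@R_α(g) = (1/(1−α)) ∫_α^1 F_g^{-1}(u) du`. -/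
def avar (P : Measure Ω) (g : Ω → ℝ) (α : ℝ) : ℝ≥0∞ :=
  ENNReal.ofReal (1 / (1 - α)) *
    ∫⁻ u in Set.Ioo α 1, ENNReal.ofReal (quantileFn P g u)

/-- `Z'` σ-dominates `Z`: there is a uniform `U` with
`AV@R_α(σ(U)·|Z'|) ≥ AV@R_α(|Z|)` for all `α < 1`. -/
def SigmaDominates (P : Measure Ω) (σ : ℝ → ℝ) (Z' Z : Ω → 𝕂) : Prop :=
  ∃ U : Ω → ℝ, IsUniformRV P U ∧ ∀ α ∈ Set.Ico (0 : ℝ) 1,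
    avar P (fun ω => ‖Z ω‖) α ≤ avar P (fun ω => σ (U ω) * ‖Z' ω‖) α

/-- `|Z|*_{σ,∞} = sup_{α ∈ [0,1)} AV@R_α(|Z|) / ((1/(1−α))·S_σ(α))
 = sup_{α ∈ [0,1)} (∫_α^1 F_{|Z|}^{-1}(u) du) / (∫_α^1 σ(u) du)`. -/
def dualNormInf (P : Measure Ω) (σ : ℝ → ℝ) (Z : Ω → 𝕂) : ℝ≥0∞ :=
  ⨆ (α : ℝ) (_ : α ∈ Set.Ico (0 : ℝ) 1),
    (∫⁻ u in Set.Ioo α 1, ENNReal.ofReal (quantileFn P (fun ω => ‖Z ω‖) u)) /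
      ENNReal.ofReal (∫ u in Set.Ioo α 1, σ u)

/-- `|Z|*_{σ,q} = inf {‖Z'‖_{σ,q} : Z' σ-dominates Z}` (with `inf ∅ = ∞`). -/
def dualNormQ (P : Measure Ω) (σ : ℝ → ℝ) (q : ℝ) (Z : Ω → 𝕂) : ℝ≥0∞ :=
  ⨅ (Z' : Ω → 𝕂) (_ : AEStronglyMeasurable Z' P ∧ SigmaDominates P σ Z' Z),
    sigmaNorm P σ q Z'

lemma IsUniformRV.map_eq {P : Measure Ω} [IsProbabilityMeasure P] {U : Ω → ℝ}
    (hU : IsUniformRV P U) : P.map U = volume.restrict (Set.Icc (0 : ℝ) 1) := by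
  have := Measure.isProbabilityMeasure_map (μ := P) hU.1.aemeasurable
  refine Measure.ext_of_Iic _ _ fun a => ?_
  rw [Measure.map_apply hU.1 measurableSet_Iic, Measure.restrict_apply measurableSet_Iic]
  rcases lt_or_ge a 0 with ha | ha
  · have h1 : U ⁻¹' Set.Iic a = ∅ := by
      ext ω
      have := (hU.2.1 ω).1
      simp only [Set.mem_preimage, Set.mem_Iic, Set.mem_empty_iff_false, iff_false]
      linarith
    have h2 : Set.Iic a ∩ Set.Icc (0 : ℝ) 1 = ∅ := by
      ext x
      simp only [Set.mem_inter_iff, Set.mem_Iic, Set.mem_Icc, Set.mem_empty_iff_false, iff_false]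
      intro h
      linarith [h.1, h.2.1]
    rw [h1, h2, measure_empty, measure_empty]
  · rcases le_or_gt a 1 with h1 | h1
    · have h2 : Set.Iic a ∩ Set.Icc (0 : ℝ) 1 = Set.Icc 0 a := by
        ext x
        simp only [Set.mem_inter_iff, Set.mem_Iic, Set.mem_Icc]
        constructor
        · intro h
          exact ⟨h.2.1, h.1⟩
        · intro h
          exact ⟨h.2, h.1, h.2.trans h1⟩
      rw [h2, Real.volume_Icc, sub_zero, ← hU.2.2 a ⟨ha, h1⟩]
      rfl
    · have h2 : Set.Iic a ∩ Set.Icc (0 : ℝ) 1 = Set.Icc 0 1 :=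
        Set.inter_eq_right.2 fun x hx => hx.2.trans h1.le
      have h3 : U ⁻¹' Set.Iic a = Set.univ :=
        Set.eq_univ_of_forall fun ω => (hU.2.1 ω).2.trans h1.le
      rw [h2, h3, Real.volume_Icc, measure_univ]
      simp

lemma IsUniformRV.lintegral_comp {P : Measure Ω} [IsProbabilityMeasure P] {U : Ω → ℝ}
    (hU : IsUniformRV P U) {τ : ℝ → ℝ≥0∞} (hτ : Measurable τ) :
    ∫⁻ ω, τ (U ω) ∂P = ∫⁻ u in Set.Icc (0 : ℝ) 1, τ u := by
  rw [← hU.map_eq, lintegral_map hτ hU.1]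

lemma isUniformRV_cdf {P : Measure Ω} [IsProbabilityMeasure P] {X : Ω → ℝ} (hX : Measurable X)
    (h : ∀ x, P {ω | X ω = x} = 0) :
    IsUniformRV P (fun ω => ProbabilityTheory.cdf (P.map X) (X ω)) := by
  have := Measure.isProbabilityMeasure_map (μ := P) hX.aemeasurable
  set F := ProbabilityTheory.cdf (P.map X) with hF
  have hmono : Monotone F := ProbabilityTheory.monotone_cdf _
  have hcont : Continuous F := by
    refine continuous_iff_continuousAt.2 fun x => ?_
    rw [hmono.continuousAt_iff_leftLim_eq_rightLim, StieltjesFunction.rightLim_eq]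
    have h1 : F.measure {x} = 0 := by
      rw [hF, ProbabilityTheory.measure_cdf, Measure.map_apply hX (measurableSet_singleton x)]
      exact h x
    rw [StieltjesFunction.measure_singleton, ENNReal.ofReal_eq_zero] at h1
    exact le_antisymm (hmono.leftLim_le le_rfl) (by linarith)
  refine ⟨hcont.measurable.comp hX, fun ω => ⟨ProbabilityTheory.cdf_nonneg _ _,
    ProbabilityTheory.cdf_le_one _ _⟩, fun u hu => ?_⟩
  rcases hu.2.eq_or_lt with rfl | hu1
  · have : {ω | F (X ω) ≤ 1} = Set.univ :=
      Set.eq_univ_of_forall fun ω => ProbabilityTheory.cdf_le_one _ _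
    rw [this, measure_univ, ENNReal.ofReal_one]
  set S := {x | F x ≤ u} with hS
  have hSc : IsClosed S := isClosed_le hcont continuous_const
  have hSb : BddAbove S := by
    obtain ⟨b, hb⟩ := ((ProbabilityTheory.tendsto_cdf_atTop (P.map X)).eventually
      (lt_mem_nhds hu1)).exists
    refine ⟨b, fun x hx => ?_⟩
    by_contra! hbx
    exact absurd (hmono hbx.le) (not_le.2 (lt_of_le_of_lt hx hb))
  rcases S.eq_empty_or_nonempty with hSe | hSn
  · have hu0 : u = 0 := by
      by_contra hne
      obtain ⟨b, hb⟩ := ((ProbabilityTheory.tendsto_cdf_atBot (P.map X)).eventually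
        (gt_mem_nhds (lt_of_le_of_ne hu.1 (Ne.symm hne)))).exists
      have : b ∈ S := hb.le
      rw [hSe] at this
      exact this
    have : {ω | F (X ω) ≤ u} = ∅ := by
      ext ω
      simp only [Set.mem_ofPred_eq, Set.mem_empty_iff_false, iff_false]
      intro hω
      have : X ω ∈ S := hω
      rw [hSe] at this
      exact this
    rw [this, measure_empty, hu0, ENNReal.ofReal_zero]
  · have hmem : sSup S ∈ S := hSc.csSup_mem hSn hSb
    have heq : F (sSup S) = u := by
      refine le_antisymm hmem ?_
      have ht : Filter.Tendsto F (nhdsWithin (sSup S) (Set.Ioi (sSup S))) (nhds (F (sSup S))) :=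
        hcont.continuousAt.tendsto.mono_left nhdsWithin_le_nhds
      refine ge_of_tendsto ht ?_
      filter_upwards [self_mem_nhdsWithin] with y hy
      by_contra! hyu
      exact absurd (le_csSup hSb (show y ∈ S from hyu.le)) (not_le.2 hy)
    have hset : {ω | F (X ω) ≤ u} = X ⁻¹' Set.Iic (sSup S) := by
      ext ω
      exact ⟨fun hω => le_csSup hSb hω, fun hω => (hmono hω).trans hmem⟩
    rw [hset, ← Measure.map_apply hX measurableSet_Iic, ← ProbabilityTheory.ofReal_cdf, ← hF, heq]

/-- For every nonnegative random variable there is a uniform random variable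
that is comonotone with its integer part. -/
lemma exists_comonotone {P : Measure Ω} [IsProbabilityMeasure P]
    (hrich : ∃ U : Ω → ℝ, IsUniformRV P U) {g : Ω → ℝ≥0} (hg : Measurable g) :
    ∃ V : Ω → ℝ, IsUniformRV P V ∧
      ∀ (n : ℕ) (ω ω' : Ω), (n : ℝ≥0) ≤ g ω → ¬ (n : ℝ≥0) ≤ g ω' → V ω' ≤ V ω := by
  obtain ⟨U, hU⟩ := hrich
  set X : Ω → ℝ := fun ω => (⌊g ω⌋₊ : ℝ) + U ω / 2 with hX
  have hXm : Measurable X :=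
    ((measurable_from_nat (f := fun n : ℕ => (n : ℝ))).comp hg.nat_floor).add (hU.1.div_const 2)
  have hU0 : ∀ x, P {ω | U ω = x} = 0 := by
    intro x
    have : {ω | U ω = x} = U ⁻¹' {x} := rfl
    rw [this, ← Measure.map_apply hU.1 (measurableSet_singleton x), hU.map_eq]
    exact measure_singleton x
  refine ⟨_, isUniformRV_cdf hXm ?_, ?_⟩
  · intro x
    have : {ω | X ω = x} ⊆ ⋃ n : ℕ, {ω | U ω = 2 * (x - n)} := by
      intro ω hω
      refine Set.mem_iUnion.2 ⟨⌊g ω⌋₊, ?_⟩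
      have hω' : (⌊g ω⌋₊ : ℝ) + U ω / 2 = x := hω
      show U ω = 2 * (x - (⌊g ω⌋₊ : ℝ))
      linarith
    exact measure_mono_null this (measure_iUnion_null fun n => hU0 _)
  · intro n ω ω' h1 h2
    refine ProbabilityTheory.monotone_cdf _ ?_
    have h3 : n ≤ ⌊g ω⌋₊ := Nat.le_floor h1
    have h4 : ⌊g ω'⌋₊ < n := (Nat.floor_lt (zero_le)).2 (not_le.1 h2)
    have h5 : ((⌊g ω'⌋₊ : ℝ)) + 1 ≤ ⌊g ω⌋₊ := by exact_mod_cast h4.trans_le h3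
    have h6 := (hU.2.1 ω).1
    have h7 := (hU.2.1 ω').2
    simp only [hX]
    linarith

lemma setLIntegral_comp_le_of_comonotone {P : Measure Ω} [IsProbabilityMeasure P] {U V : Ω → ℝ}
    (hU : IsUniformRV P U) (hV : IsUniformRV P V) {τ : ℝ → ℝ≥0∞} (hτ : Monotone τ) {B : Set Ω}
    (hB : MeasurableSet B) (hVB : ∀ ω ∈ B, ∀ ω' ∉ B, V ω' ≤ V ω) :
    ∫⁻ ω in B, τ (U ω) ∂P ≤ ∫⁻ ω in B, τ (V ω) ∂P := by
  set c : ℝ≥0∞ := ⨅ ω ∈ B, τ (V ω) with hc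
  have hcB : ∀ ω ∈ B, c ≤ τ (V ω) := fun ω hω => iInf₂_le ω hω
  have hcBc : ∀ ω' ∉ B, τ (V ω') ≤ c := fun ω' hω' =>
    le_iInf₂ fun ω hω => hτ (hVB ω hω ω' hω')
  have hm : Measurable fun u => τ u - c := hτ.measurable.sub_const c
  have hmV : Measurable fun ω => τ (V ω) - c := hm.comp hV.1
  calc ∫⁻ ω in B, τ (U ω) ∂P ≤ ∫⁻ ω in B, (c + (τ (U ω) - c)) ∂P :=
        lintegral_mono fun ω => le_add_tsub
    _ = ∫⁻ _ in B, c ∂P + ∫⁻ ω in B, (τ (U ω) - c) ∂P := lintegral_add_left measurable_const _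
    _ ≤ ∫⁻ _ in B, c ∂P + ∫⁻ ω, (τ (U ω) - c) ∂P := by
        gcongr
        exact Measure.restrict_le_self
    _ = ∫⁻ _ in B, c ∂P + ∫⁻ ω, (τ (V ω) - c) ∂P := by
        rw [hU.lintegral_comp hm, hV.lintegral_comp hm]
    _ = ∫⁻ _ in B, c ∂P + ∫⁻ ω in B, (τ (V ω) - c) ∂P := by
        rw [← lintegral_add_compl (fun ω => τ (V ω) - c) hB]
        have : ∫⁻ ω in Bᶜ, (τ (V ω) - c) ∂P = 0 := by
          rw [setLIntegral_congr_fun (g := fun _ => 0) hB.compl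
            fun ω hω => tsub_eq_zero_of_le (hcBc ω hω)]
          simp
        rw [this, add_zero]
    _ = ∫⁻ ω in B, (c + (τ (V ω) - c)) ∂P := (lintegral_add_left measurable_const _).symm
    _ = ∫⁻ ω in B, τ (V ω) ∂P :=
        setLIntegral_congr_fun hB fun ω hω => add_tsub_cancel_of_le (hcB ω hω)

lemma measure_mul_lintegral_le_of_comonotone {P : Measure Ω} [IsProbabilityMeasure P] {V : Ω → ℝ}
    {τ : ℝ → ℝ≥0∞} (hτ : Monotone τ) {B : Set Ω}
    (hB : MeasurableSet B) (hVB : ∀ ω ∈ B, ∀ ω' ∉ B, V ω' ≤ V ω) :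
    P B * ∫⁻ ω, τ (V ω) ∂P ≤ ∫⁻ ω in B, τ (V ω) ∂P := by
  set c : ℝ≥0∞ := ⨅ ω ∈ B, τ (V ω) with hc
  have h1 : ∫⁻ ω in Bᶜ, τ (V ω) ∂P ≤ c * P Bᶜ := by
    rw [← setLIntegral_const]
    exact setLIntegral_mono measurable_const fun ω' hω' =>
      le_iInf₂ fun ω hω => hτ (hVB ω hω ω' hω')
  have h2 : c * P B ≤ ∫⁻ ω in B, τ (V ω) ∂P := by
    rw [← setLIntegral_const]
    exact setLIntegral_mono' hB fun ω hω => iInf₂_le ω hω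
  rw [← lintegral_add_compl _ hB]
  calc P B * (∫⁻ ω in B, τ (V ω) ∂P + ∫⁻ ω in Bᶜ, τ (V ω) ∂P)
      ≤ P B * (∫⁻ ω in B, τ (V ω) ∂P + c * P Bᶜ) := by gcongr
    _ = P B * ∫⁻ ω in B, τ (V ω) ∂P + (c * P B) * P Bᶜ := by ring
    _ ≤ P B * ∫⁻ ω in B, τ (V ω) ∂P + (∫⁻ ω in B, τ (V ω) ∂P) * P Bᶜ := by gcongr
    _ = (P B + P Bᶜ) * ∫⁻ ω in B, τ (V ω) ∂P := by ring
    _ = ∫⁻ ω in B, τ (V ω) ∂P := by rw [measure_add_measure_compl hB, measure_univ, one_mul]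

lemma tsum_indicator_natCast_le (x : ℝ≥0) :
    (x : ℝ≥0∞) ≤ ∑' n : ℕ, (if (n : ℝ≥0) ≤ x then 1 else 0 : ℝ≥0∞) ∧
      ∑' n : ℕ, (if (n : ℝ≥0) ≤ x then 1 else 0 : ℝ≥0∞) ≤ x + 1 := by
  have h : ∑' n : ℕ, (if (n : ℝ≥0) ≤ x then 1 else 0 : ℝ≥0∞) = ((⌊x⌋₊ + 1 : ℝ≥0) : ℝ≥0∞) := by
    rw [tsum_eq_sum (s := Finset.range (⌊x⌋₊ + 1))]
    · rw [Finset.sum_congr rfl (g := fun _ => 1)]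
      · simp
      · intro n hn
        rw [if_pos]
        exact (Nat.le_floor_iff (zero_le)).1 (Nat.lt_succ_iff.1 (Finset.mem_range.1 hn))
    · intro n hn
      rw [if_neg]
      intro h
      exact hn (Finset.mem_range.2 (Nat.lt_succ_iff.2 (Nat.le_floor h)))
  rw [h]
  constructor
  · exact_mod_cast (Nat.lt_floor_add_one x).le
  · have : (⌊x⌋₊ + 1 : ℝ≥0) ≤ x + 1 := by gcongr; exact Nat.floor_le (zero_le)
    exact_mod_cast this

lemma lintegral_mul_tsum_indicator {P : Measure Ω} {f : Ω → ℝ≥0∞} (hf : Measurable f)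
    {g : Ω → ℝ≥0} (hg : Measurable g) :
    ∫⁻ ω, f ω * ∑' n : ℕ, (if (n : ℝ≥0) ≤ g ω then 1 else 0 : ℝ≥0∞) ∂P
      = ∑' n : ℕ, ∫⁻ ω in {ω | (n : ℝ≥0) ≤ g ω}, f ω ∂P := by
  have hm : ∀ n : ℕ, MeasurableSet {ω | (n : ℝ≥0) ≤ g ω} := fun n =>
    measurableSet_le measurable_const hg
  simp_rw [← ENNReal.tsum_mul_left]
  rw [lintegral_tsum]
  · refine tsum_congr fun n => ?_
    rw [← lintegral_indicator (hm n)]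
    refine lintegral_congr fun ω => ?_
    by_cases h : (n : ℝ≥0) ≤ g ω
    · rw [Set.indicator_of_mem (show ω ∈ {ω | (n : ℝ≥0) ≤ g ω} from h), if_pos h, mul_one]
    · rw [Set.indicator_of_notMem (show ω ∉ {ω | (n : ℝ≥0) ≤ g ω} from h), if_neg h, mul_zero]
  · exact fun n => (hf.mul (Measurable.ite (hm n) measurable_const measurable_const)).aemeasurable

/-- A rearrangement inequality: up to an additive constant, the supremum defining the
`σ`-norm is attained at one uniform random variable, simultaneously for all monotone `τ`. -/
lemma exists_isUniformRV_lintegral_le {P : Measure Ω} [IsProbabilityMeasure P]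
    (hrich : ∃ U : Ω → ℝ, IsUniformRV P U) {g : Ω → ℝ≥0} (hg : Measurable g) :
    ∃ V : Ω → ℝ, IsUniformRV P V ∧ ∀ τ : ℝ → ℝ≥0∞, Monotone τ →
      (∀ U, IsUniformRV P U →
        ∫⁻ ω, τ (U ω) * g ω ∂P ≤ ∫⁻ ω, τ (V ω) * (g ω + 1) ∂P) ∧
      (∫⁻ ω, g ω ∂P) * ∫⁻ ω, τ (V ω) ∂P ≤ ∫⁻ ω, τ (V ω) * (g ω + 1) ∂P := by
  obtain ⟨V, hV, hVg⟩ := exists_comonotone hrich hg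
  have hm : ∀ n : ℕ, MeasurableSet {ω | (n : ℝ≥0) ≤ g ω} := fun n =>
    measurableSet_le measurable_const hg
  refine ⟨V, hV, fun τ hτ => ?_⟩
  have hle : ∑' n : ℕ, ∫⁻ ω in {ω | (n : ℝ≥0) ≤ g ω}, τ (V ω) ∂P
      ≤ ∫⁻ ω, τ (V ω) * (g ω + 1) ∂P := by
    rw [← lintegral_mul_tsum_indicator (f := fun ω => τ (V ω)) (hτ.measurable.comp hV.1) hg]
    exact lintegral_mono fun ω => mul_le_mul_right (tsum_indicator_natCast_le _).2 _
  refine ⟨fun U hU => le_trans ?_ hle, le_trans ?_ hle⟩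
  · calc ∫⁻ ω, τ (U ω) * g ω ∂P
        ≤ ∫⁻ ω, τ (U ω) * ∑' n : ℕ, (if (n : ℝ≥0) ≤ g ω then 1 else 0 : ℝ≥0∞) ∂P :=
          lintegral_mono fun ω => mul_le_mul_right (tsum_indicator_natCast_le _).1 _
      _ = ∑' n : ℕ, ∫⁻ ω in {ω | (n : ℝ≥0) ≤ g ω}, τ (U ω) ∂P :=
          lintegral_mul_tsum_indicator (hτ.measurable.comp hU.1) hg
      _ ≤ _ := ENNReal.tsum_le_tsum fun n =>
          setLIntegral_comp_le_of_comonotone hU hV hτ (hm n) fun ω hω ω' hω' => hVg n ω ω' hω hω'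
  · calc (∫⁻ ω, g ω ∂P) * ∫⁻ ω, τ (V ω) ∂P
        ≤ (∫⁻ ω, 1 * ∑' n : ℕ, (if (n : ℝ≥0) ≤ g ω then 1 else 0 : ℝ≥0∞) ∂P)
            * ∫⁻ ω, τ (V ω) ∂P := by
          gcongr with ω
          rw [one_mul]
          exact (tsum_indicator_natCast_le _).1
      _ = ∑' n : ℕ, P {ω | (n : ℝ≥0) ≤ g ω} * ∫⁻ ω, τ (V ω) ∂P := by
          rw [lintegral_mul_tsum_indicator measurable_const hg, ENNReal.tsum_mul_right]
          simp
      _ ≤ _ := ENNReal.tsum_le_tsum fun n =>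
          measure_mul_lintegral_le_of_comonotone hτ (hm n) fun ω hω ω' hω' => hVg n ω ω' hω hω'

/-- The extension of a distortion function to a monotone function on the whole real line. -/
def distortionExt (σ : ℝ → ℝ) (u : ℝ) : ℝ≥0∞ :=
  if u < 0 then 0 else if u < 1 then ENNReal.ofReal (σ u) else ∞

lemma IsDistortion.monotone_ext {σ : ℝ → ℝ} (hσ : IsDistortion σ) :
    Monotone (distortionExt σ) := by
  intro u v huv
  unfold distortionExt
  split_ifs with h1 h2 h3 h4 h5 h6 h7
  any_goals simp
  all_goals first
    | linarith
    | exact ENNReal.ofReal_le_ofReal (hσ.mono ⟨not_lt.1 h1, by linarith⟩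
        ⟨by linarith, by linarith⟩ huv)

lemma IsUniformRV.measurable_ext {P : Measure Ω} {U : Ω → ℝ} (hU : IsUniformRV P U) {σ : ℝ → ℝ}
    (hσ : IsDistortion σ) : Measurable fun ω => distortionExt σ (U ω) :=
  hσ.monotone_ext.measurable.comp hU.1

lemma IsUniformRV.ae_eq_ext {P : Measure Ω} [IsProbabilityMeasure P] {U : Ω → ℝ}
    (hU : IsUniformRV P U) (σ : ℝ → ℝ) :
    ∀ᵐ ω ∂P, ENNReal.ofReal (σ (U ω)) = distortionExt σ (U ω) := by
  have h : P (U ⁻¹' {1}) = 0 := by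
    rw [← Measure.map_apply hU.1 (measurableSet_singleton _), hU.map_eq]
    exact measure_singleton _
  have h' : ∀ᵐ ω ∂P, ω ∉ U ⁻¹' {1} := measure_eq_zero_iff_ae_notMem.1 h
  filter_upwards [h'] with ω hω
  have h1 := hU.2.1 ω
  have h2 : U ω < 1 := lt_of_le_of_ne h1.2 hω
  rw [distortionExt, if_neg (not_lt.2 h1.1), if_pos h2]

lemma IsUniformRV.lintegral_ext {P : Measure Ω} [IsProbabilityMeasure P] {U : Ω → ℝ}
    (hU : IsUniformRV P U) {σ : ℝ → ℝ} (hσ : IsDistortion σ) :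
    ∫⁻ ω, distortionExt σ (U ω) ∂P = 1 := by
  rw [hU.lintegral_comp hσ.monotone_ext.measurable]
  rw [← Measure.restrict_congr_set (Ioo_ae_eq_Icc (α := ℝ) (μ := volume) (a := 0) (b := 1))]
  have hint : IntegrableOn σ (Set.Ioo 0 1) := by
    by_contra h
    have := hσ.integral_one
    rw [integral_undef h] at this
    exact zero_ne_one this
  have h1 := ofReal_integral_eq_lintegral_ofReal hint (by
    filter_upwards [ae_restrict_mem measurableSet_Ioo] with u hu
    exact hσ.nonneg u ⟨hu.1.le, hu.2⟩)
  rw [hσ.integral_one, ENNReal.ofReal_one] at h1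
  rw [h1]
  refine setLIntegral_congr_fun measurableSet_Ioo fun u hu => ?_
  simp only [distortionExt]
  rw [if_neg (not_lt.2 hu.1.le), if_pos hu.2]

section SigmaPow

variable {P : Measure Ω} {σ : ℝ → ℝ} {p : ℝ}
  {X : Type*} [NormedAddCommGroup X]

lemma exists_measurable_norm_rpow (hp : 0 ≤ p) {Y : Ω → X} (hY : AEStronglyMeasurable Y P) :
    ∃ g : Ω → ℝ≥0, Measurable g ∧ ∀ᵐ ω ∂P, (‖Y ω‖₊ : ℝ≥0∞) ^ p = g ω := by
  have h : AEMeasurable (fun ω => ‖Y ω‖₊ ^ p) P := hY.nnnorm.aemeasurable.pow_const p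
  refine ⟨h.mk _, h.measurable_mk, ?_⟩
  filter_upwards [h.ae_eq_mk] with ω hω
  rw [← hω, ENNReal.coe_rpow_of_nonneg _ hp]

lemma IsUniformRV.lintegral_congr_ext [IsProbabilityMeasure P] {U : Ω → ℝ} (hU : IsUniformRV P U)
    {Y : Ω → X}
    {g : Ω → ℝ≥0} (hg : ∀ᵐ ω ∂P, (‖Y ω‖₊ : ℝ≥0∞) ^ p = g ω) :
    ∫⁻ ω, ENNReal.ofReal (σ (U ω)) * (‖Y ω‖₊ : ℝ≥0∞) ^ p ∂P
      = ∫⁻ ω, distortionExt σ (U ω) * g ω ∂P := by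
  refine lintegral_congr_ae ?_
  filter_upwards [hg, hU.ae_eq_ext σ] with ω h1 h2
  rw [h1, h2]

lemma IsUniformRV.lintegral_le_sigmaPow {U : Ω → ℝ} (hU : IsUniformRV P U) (Y : Ω → X) :
    ∫⁻ ω, ENNReal.ofReal (σ (U ω)) * (‖Y ω‖₊ : ℝ≥0∞) ^ p ∂P ≤ sigmaPow P σ p Y :=
  le_iSup₂ (f := fun (U : Ω → ℝ) (_ : IsUniformRV P U) =>
    ∫⁻ ω, ENNReal.ofReal (σ (U ω)) * (‖Y ω‖₊ : ℝ≥0∞) ^ p ∂P) U hU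

lemma sigmaPow_congr {Y Y' : Ω → X} (h : Y =ᵐ[P] Y') : sigmaPow P σ p Y = sigmaPow P σ p Y' := by
  refine iSup_congr fun U => iSup_congr fun _ => lintegral_congr_ae ?_
  filter_upwards [h] with ω hω
  rw [hω]

lemma sigmaPow_mono (hp : 0 ≤ p) {Y Y' : Ω → X} (h : ∀ ω, ‖Y ω‖ ≤ ‖Y' ω‖) :
    sigmaPow P σ p Y ≤ sigmaPow P σ p Y' := by
  refine iSup₂_mono fun U _ => lintegral_mono fun ω => ?_
  have : ‖Y ω‖₊ ≤ ‖Y' ω‖₊ := h ω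
  dsimp only
  gcongr

lemma sigmaPow_le_of_bound [IsProbabilityMeasure P] (hσ : IsDistortion σ) (hp : 0 ≤ p)
    {Y : Ω → X} {C : ℝ≥0}
    (h : ∀ ω, ‖Y ω‖₊ ≤ C) : sigmaPow P σ p Y ≤ (C : ℝ≥0∞) ^ p := by
  refine iSup₂_le fun U hU => ?_
  calc ∫⁻ ω, ENNReal.ofReal (σ (U ω)) * (‖Y ω‖₊ : ℝ≥0∞) ^ p ∂P
      ≤ ∫⁻ ω, ENNReal.ofReal (σ (U ω)) * (C : ℝ≥0∞) ^ p ∂P := by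
        gcongr with ω
        exact h ω
    _ = ∫⁻ ω, distortionExt σ (U ω) * (C : ℝ≥0∞) ^ p ∂P := by
        refine lintegral_congr_ae ?_
        filter_upwards [hU.ae_eq_ext σ] with ω h2
        rw [h2]
    _ = (C : ℝ≥0∞) ^ p := by
        rw [lintegral_mul_const _ (hU.measurable_ext hσ), hU.lintegral_ext hσ,
          one_mul]

lemma sigmaPow_add_le_of_disjoint [IsProbabilityMeasure P] (hσ : IsDistortion σ) (hp : 0 < p)
    {Y Y' : Ω → X}
    (hY : AEStronglyMeasurable Y P) (h : ∀ ω, Y ω = 0 ∨ Y' ω = 0) :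
    sigmaPow P σ p (Y + Y') ≤ sigmaPow P σ p Y + sigmaPow P σ p Y' := by
  refine iSup₂_le fun U hU => ?_
  calc ∫⁻ ω, ENNReal.ofReal (σ (U ω)) * (‖(Y + Y') ω‖₊ : ℝ≥0∞) ^ p ∂P
      = ∫⁻ ω, (ENNReal.ofReal (σ (U ω)) * (‖Y ω‖₊ : ℝ≥0∞) ^ p
          + ENNReal.ofReal (σ (U ω)) * (‖Y' ω‖₊ : ℝ≥0∞) ^ p) ∂P := by
        refine lintegral_congr fun ω => ?_
        rcases h ω with h0 | h0 <;> simp [h0, ENNReal.zero_rpow_of_pos hp]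
    _ = ∫⁻ ω, ENNReal.ofReal (σ (U ω)) * (‖Y ω‖₊ : ℝ≥0∞) ^ p ∂P
          + ∫⁻ ω, ENNReal.ofReal (σ (U ω)) * (‖Y' ω‖₊ : ℝ≥0∞) ^ p ∂P := by
        obtain ⟨g, hg, hYg⟩ := exists_measurable_norm_rpow hp.le hY
        refine lintegral_add_left' ?_ _
        refine ((hU.measurable_ext hσ).mul hg.coe_nnreal_ennreal).aemeasurable.congr
          ?_
        filter_upwards [hYg, hU.ae_eq_ext σ] with ω h1 h2
        simp [h1, h2]
    _ ≤ _ := add_le_add (hU.lintegral_le_sigmaPow Y) (hU.lintegral_le_sigmaPow Y')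

lemma lintegral_rpow_le_sigmaPow_add_one [IsProbabilityMeasure P]
    (hrich : ∃ U : Ω → ℝ, IsUniformRV P U)
    (hσ : IsDistortion σ) (hp : 0 ≤ p) {Y : Ω → X} (hY : AEStronglyMeasurable Y P) :
    ∫⁻ ω, (‖Y ω‖₊ : ℝ≥0∞) ^ p ∂P ≤ sigmaPow P σ p Y + 1 := by
  obtain ⟨g, hg, hYg⟩ := exists_measurable_norm_rpow hp hY
  obtain ⟨V, hV, hVτ⟩ := exists_isUniformRV_lintegral_le hrich hg
  have h := (hVτ _ hσ.monotone_ext).2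
  rw [hV.lintegral_ext hσ, mul_one] at h
  rw [lintegral_congr_ae hYg]
  refine h.trans ?_
  simp_rw [mul_add, mul_one]
  rw [lintegral_add_right _ (hV.measurable_ext hσ), hV.lintegral_ext hσ,
    ← hV.lintegral_congr_ext hYg]
  gcongr
  exact hV.lintegral_le_sigmaPow Y

/-- The `σ`-norm is absolutely continuous. -/
lemma exists_sigmaPow_indicator_le [IsProbabilityMeasure P] (hrich : ∃ U : Ω → ℝ, IsUniformRV P U)
    (hσ : IsDistortion σ) (hp : 0 < p) {Y : Ω → X} (hY : MemLsigma P σ p Y)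
    {ε : ℝ≥0∞} (hε : ε ≠ 0) :
    ∃ δ > 0, ∀ A : Set Ω, MeasurableSet A → P A < δ → sigmaPow P σ p (A.indicator Y) ≤ ε := by
  obtain ⟨g, hg, hYg⟩ := exists_measurable_norm_rpow hp.le hY.1
  obtain ⟨V, hV, hVτ⟩ := exists_isUniformRV_lintegral_le hrich hg
  have hfin : ∫⁻ ω, distortionExt σ (V ω) * (g ω + 1) ∂P ≠ ∞ := by
    simp_rw [mul_add, mul_one]
    rw [lintegral_add_right _ (hV.measurable_ext hσ), hV.lintegral_ext hσ,
      ← hV.lintegral_congr_ext hYg]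
    exact ENNReal.add_ne_top.2
      ⟨((hV.lintegral_le_sigmaPow Y).trans_lt hY.2).ne, ENNReal.one_ne_top⟩
  have hgfin : ∫⁻ ω, g ω ∂P ≠ ∞ := by
    have h := (hVτ _ hσ.monotone_ext).2
    rw [hV.lintegral_ext hσ, mul_one] at h
    exact (h.trans_lt hfin.lt_top).ne
  have hτ : ∀ K : ℕ, Monotone fun u => distortionExt σ u - K := fun K u v huv =>
    tsub_le_tsub_right (hσ.monotone_ext huv) _
  have hlim : Filter.Tendsto
      (fun K : ℕ => ∫⁻ ω, (distortionExt σ (V ω) - K) * (g ω + 1) ∂P) Filter.atTop (nhds 0) := by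
    have h0 : ∫⁻ _ : Ω, (0 : ℝ≥0∞) ∂P = 0 := lintegral_zero
    rw [← h0]
    refine tendsto_lintegral_of_dominated_convergence
      (fun ω => distortionExt σ (V ω) * (g ω + 1)) (fun K => ?_) (fun K => ?_) hfin ?_
    · exact ((hτ K).measurable.comp hV.1).mul (hg.coe_nnreal_ennreal.add_const 1)
    · exact Filter.Eventually.of_forall fun ω => mul_le_mul_left tsub_le_self _
    · filter_upwards [hV.ae_eq_ext σ] with ω hω
      obtain ⟨N, hN⟩ := ENNReal.exists_nat_gt (r := distortionExt σ (V ω))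
        (by rw [← hω]; exact ENNReal.ofReal_ne_top)
      refine tendsto_const_nhds.congr' ?_
      filter_upwards [Filter.eventually_ge_atTop N] with K hK
      rw [tsub_eq_zero_of_le, zero_mul]
      exact hN.le.trans (by exact_mod_cast hK)
  obtain ⟨K, hK⟩ := ((hlim.eventually (gt_mem_nhds (ENNReal.half_pos hε))).exists)
  have hη : ε / 2 / (K + 1 : ℝ≥0∞) ≠ 0 :=
    (ENNReal.div_pos (ENNReal.half_pos hε).ne' (by finiteness)).ne'
  obtain ⟨δ, hδ, hA⟩ := exists_pos_setLIntegral_lt_of_measure_lt hgfin hη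
  refine ⟨δ, hδ, fun A hAm hAδ => iSup₂_le fun U hU => ?_⟩
  calc ∫⁻ ω, ENNReal.ofReal (σ (U ω)) * (‖A.indicator Y ω‖₊ : ℝ≥0∞) ^ p ∂P
      = ∫⁻ ω in A, distortionExt σ (U ω) * g ω ∂P := by
        rw [← lintegral_indicator hAm]
        refine lintegral_congr_ae ?_
        filter_upwards [hYg, hU.ae_eq_ext σ] with ω h1 h2
        by_cases hω : ω ∈ A
        · simp only [Set.indicator_of_mem hω, h1, h2]
        · simp [Set.indicator_of_notMem hω, ENNReal.zero_rpow_of_pos hp]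
    _ ≤ ∫⁻ ω in A, (K * g ω + (distortionExt σ (U ω) - K) * g ω) ∂P := by
        refine lintegral_mono fun ω => ?_
        rw [← add_mul]
        exact mul_le_mul_left le_add_tsub _
    _ = K * ∫⁻ ω in A, g ω ∂P + ∫⁻ ω in A, (distortionExt σ (U ω) - K) * g ω ∂P := by
        rw [lintegral_add_left (hg.coe_nnreal_ennreal.const_mul _),
          lintegral_const_mul _ hg.coe_nnreal_ennreal]
    _ ≤ K * (ε / 2 / (K + 1 : ℝ≥0∞)) + ε / 2 := by
        refine add_le_add (mul_le_mul_right (hA A hAδ).le _) ?_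
        refine le_trans (lintegral_mono' Measure.restrict_le_self le_rfl) ?_
        exact ((hVτ _ (hτ K)).1 U hU).trans hK.le
    _ ≤ (K + 1) * (ε / 2 / (K + 1 : ℝ≥0∞)) + ε / 2 := by
        gcongr
        exact le_self_add
    _ ≤ ε / 2 + ε / 2 := by
        gcongr
        exact ENNReal.mul_div_le
    _ = ε := ENNReal.add_halves ε

end SigmaPow

/-- The Radon–Nikodym theorem for finitely additive, absolutely continuous real set functions. -/
lemma exists_density_of_additive {P : Measure Ω} [IsProbabilityMeasure P] (m : Set Ω → ℝ)
    (hadd : ∀ A B, MeasurableSet A → MeasurableSet B → Disjoint A B → m (A ∪ B) = m A + m B)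
    (hac : ∀ ε > 0, ∃ δ > 0, ∀ A, MeasurableSet A → P A < δ → |m A| ≤ ε) :
    ∃ f : Ω → ℝ, Measurable f ∧ Integrable f P ∧
      ∀ A, MeasurableSet A → m A = ∫ ω in A, f ω ∂P := by
  classical
  have hempty : m ∅ = 0 := by
    have := hadd ∅ ∅ MeasurableSet.empty MeasurableSet.empty (Set.disjoint_empty _)
    rw [Set.union_empty] at this
    linarith
  have hsum : ∀ (f : ℕ → Set Ω), (∀ i, MeasurableSet (f i)) →
      Pairwise (Function.onFun Disjoint f) → ∀ S : Finset ℕ,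
        ∑ i ∈ S, m (f i) = m (⋃ i ∈ S, f i) := by
    intro f hf hd S
    induction S using Finset.induction_on with
    | empty => simp [hempty]
    | insert a S ha ih =>
      rw [Finset.sum_insert ha, ih, Finset.set_biUnion_insert, hadd _ _ (hf a)
        (S.measurableSet_biUnion fun i _ => hf i)]
      refine Set.disjoint_iUnion₂_right.2 fun i hi => hd ?_
      rintro rfl
      exact ha hi
  let s : SignedMeasure Ω :=
    { measureOf' := fun A => if MeasurableSet A then m A else 0
      empty' := by simp [hempty]
      not_measurable' := fun A hA => if_neg hA
      m_iUnion' := by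
        intro f hf hd
        simp only [hf, if_true, MeasurableSet.iUnion hf]
        have hPsum : ∑' i, P (f i) ≠ ∞ := by
          rw [← measure_iUnion hd hf]
          exact measure_ne_top _ _
        refine Metric.tendsto_nhds.2 fun ε hε => ?_
        obtain ⟨δ, hδ, hA⟩ := hac (ε / 2) (half_pos hε)
        filter_upwards [(ENNReal.tendsto_tsum_compl_atTop_zero hPsum).eventually
          (gt_mem_nhds hδ)] with S hS
        rw [hsum f hf hd S]
        have hm : MeasurableSet (⋃ i : {x // x ∉ S}, f i) := MeasurableSet.iUnion fun i => hf i
        have hu : (⋃ i, f i) = (⋃ i ∈ S, f i) ∪ ⋃ i : {x // x ∉ S}, f i := by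
          ext ω
          simp only [Set.mem_iUnion, Set.mem_union, Subtype.exists, exists_prop]
          constructor
          · rintro ⟨i, hi⟩
            by_cases h : i ∈ S
            · exact Or.inl ⟨i, h, hi⟩
            · exact Or.inr ⟨i, h, hi⟩
          · rintro (⟨i, _, hi⟩ | ⟨i, _, hi⟩) <;> exact ⟨i, hi⟩
        have hdisj : Disjoint (⋃ i ∈ S, f i) (⋃ i : {x // x ∉ S}, f i) := by
          refine Set.disjoint_iUnion₂_left.2 fun i hi => Set.disjoint_iUnion_right.2 fun j => hd ?_
          rintro rfl
          exact j.2 hi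
        rw [hu, hadd _ _ (S.measurableSet_biUnion fun i _ => hf i) hm hdisj, dist_comm,
          Real.dist_eq, add_sub_cancel_left]
        exact (hA _ hm ((measure_iUnion_le _).trans_lt hS)).trans_lt (half_lt_self hε) }
  have hs : ∀ A, MeasurableSet A → s A = m A := fun A hA => if_pos hA
  have hsac : s ≪ᵥ P.toENNRealVectorMeasure := by
    refine VectorMeasure.AbsolutelyContinuous.mk fun A hA hPA => ?_
    rw [Measure.toENNRealVectorMeasure_apply_measurable hA] at hPA
    rw [hs A hA]
    refine abs_nonpos_iff.1 (le_of_forall_pos_le_add fun ε hε => ?_)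
    obtain ⟨δ, hδ, h⟩ := hac ε hε
    rw [zero_add]
    exact h A hA (by rw [hPA]; exact hδ)
  refine ⟨s.rnDeriv P, SignedMeasure.measurable_rnDeriv _ _,
    SignedMeasure.integrable_rnDeriv _ _, fun A hA => ?_⟩
  rw [← withDensityᵥ_apply (SignedMeasure.integrable_rnDeriv _ _) hA,
    SignedMeasure.withDensityᵥ_rnDeriv_eq s P hsac, hs A hA]

lemma exists_simpleFunc_norm_sub_le {f : Ω → 𝕂} (hf : Measurable f) {C : ℝ}
    (hC : ∀ ω, ‖f ω‖ ≤ C) {ε : ℝ} (hε : 0 < ε) :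
    ∃ s : SimpleFunc Ω 𝕂, ∀ ω, ‖f ω - s ω‖ ≤ ε := by
  let e : ℕ → 𝕂 := TopologicalSpace.denseSeq 𝕂
  obtain ⟨N, hN⟩ := (isCompact_closedBall (0 : 𝕂) C).elim_directed_cover
    (fun N : ℕ => ⋃ k ∈ Finset.range (N + 1), Metric.ball (e k) ε)
    (fun N => isOpen_biUnion fun k _ => Metric.isOpen_ball)
    (fun x _ => by
      obtain ⟨k, hk⟩ := (TopologicalSpace.denseRange_denseSeq 𝕂).exists_dist_lt x hε
      exact Set.mem_iUnion.2 ⟨k, Set.mem_iUnion₂.2 ⟨k, by simp, hk⟩⟩)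
    (by
      refine Monotone.directed_le (f := fun N : ℕ => ⋃ k ∈ Finset.range (N + 1),
        Metric.ball (e k) ε) fun a b hab => ?_
      refine Set.biUnion_subset_biUnion_left fun k hk => ?_
      simp only [Finset.coe_range, Set.mem_Iio] at hk ⊢
      omega)
  refine ⟨(SimpleFunc.nearestPt e N).comp f hf, fun ω => ?_⟩
  obtain ⟨k, hk, hkb⟩ := Set.mem_iUnion₂.1 (hN (mem_closedBall_zero_iff.2 (hC ω)))
  have h1 := SimpleFunc.edist_nearestPt_le e (f ω) (Nat.lt_succ_iff.1 (Finset.mem_range.1 hk))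
  rw [edist_dist, edist_dist, ENNReal.ofReal_le_ofReal_iff dist_nonneg] at h1
  rw [← dist_eq_norm, dist_comm]
  rw [Metric.mem_ball, dist_comm] at hkb
  exact h1.trans hkb.le

/-- Bounded measurable functions. -/
def BddMeas (f : Ω → 𝕂) : Prop := Measurable f ∧ ∃ C : ℝ, ∀ ω, ‖f ω‖ ≤ C

lemma BddMeas.add {f g : Ω → 𝕂} (hf : BddMeas f) (hg : BddMeas g) : BddMeas (f + g) := by
  obtain ⟨hf, C, hC⟩ := hf
  obtain ⟨hg, D, hD⟩ := hg
  exact ⟨hf.add hg, C + D, fun ω => (norm_add_le _ _).trans (add_le_add (hC ω) (hD ω))⟩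

lemma BddMeas.const_smul {f : Ω → 𝕂} (hf : BddMeas f) (c : 𝕂) : BddMeas (c • f) := by
  obtain ⟨hf, C, hC⟩ := hf
  refine ⟨hf.const_smul c, ‖c‖ * C, fun ω => ?_⟩
  rw [Pi.smul_apply, norm_smul]
  exact mul_le_mul_of_nonneg_left (hC ω) (norm_nonneg _)

lemma BddMeas.indicator {f : Ω → 𝕂} (hf : BddMeas f) {A : Set Ω} (hA : MeasurableSet A) :
    BddMeas (A.indicator f) := by
  obtain ⟨hf, C, hC⟩ := hf
  exact ⟨hf.indicator hA, C, fun ω => (norm_indicator_le_norm_self f ω).trans (hC ω)⟩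

lemma bddMeas_const (c : 𝕂) : BddMeas (fun _ : Ω => c) :=
  ⟨measurable_const, ‖c‖, fun _ => le_rfl⟩

lemma bddMeas_simpleFunc (s : SimpleFunc Ω 𝕂) : BddMeas (s : Ω → 𝕂) :=
  ⟨s.measurable, s.exists_forall_norm_le⟩

lemma BddMeas.sub {f g : Ω → 𝕂} (hf : BddMeas f) (hg : BddMeas g) : BddMeas (f - g) := by
  have : f - g = f + (-1 : 𝕂) • g := by rw [neg_one_smul, sub_eq_add_neg]
  rw [this]
  exact hf.add (hg.const_smul _)

lemma BddMeas.integrable_mul {P : Measure Ω} {f Z : Ω → 𝕂} (hf : BddMeas f)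
    (hZ : Integrable Z P) : Integrable (fun ω => Z ω * f ω) P := by
  obtain ⟨hf, C, hC⟩ := hf
  exact hZ.mul_bdd hf.aestronglyMeasurable (Filter.Eventually.of_forall hC)

/-- Bounded, absolutely continuous functionals on bounded measurable functions
are given by integration against an integrable density. -/
lemma exists_density_of_functional {P : Measure Ω} [IsProbabilityMeasure P] (L : (Ω → 𝕂) → 𝕂)
    (hadd : ∀ f g, BddMeas f → BddMeas g → L (f + g) = L f + L g)
    (hsmul : ∀ (c : 𝕂) f, BddMeas f → L (c • f) = c * L f)
    {K : ℝ} (hbd : ∀ (f : Ω → 𝕂) (C : ℝ), Measurable f → (∀ ω, ‖f ω‖ ≤ C) → ‖L f‖ ≤ K * C)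
    (hac : ∀ ε > 0, ∃ δ > 0, ∀ A, MeasurableSet A → P A < δ →
      ‖L (A.indicator fun _ => 1)‖ ≤ ε) :
    ∃ Z : Ω → 𝕂, Measurable Z ∧ Integrable Z P ∧
      ∀ f, BddMeas f → L f = ∫ ω, Z ω * f ω ∂P := by
  have hone : ∀ A : Set Ω, MeasurableSet A → BddMeas (A.indicator fun _ => (1 : 𝕂)) :=
    fun A hA => (bddMeas_const 1).indicator hA
  have hunion : ∀ A B : Set Ω, MeasurableSet A → MeasurableSet B → Disjoint A B →
      L ((A ∪ B).indicator fun _ => 1)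
        = L (A.indicator fun _ => 1) + L (B.indicator fun _ => 1) := by
    intro A B hA hB hAB
    rw [← hadd _ _ (hone A hA) (hone B hB), Set.indicator_union_of_disjoint hAB]
    rfl
  obtain ⟨fr, hfrm, hfri, hfr⟩ := exists_density_of_additive (P := P)
    (fun A => RCLike.re (L (A.indicator fun _ => 1)))
    (fun A B hA hB hAB => by simp only [hunion A B hA hB hAB, map_add])
    (fun ε hε => (hac ε hε).imp fun δ h => ⟨h.1, fun A hA hPA =>
      (RCLike.abs_re_le_norm _).trans (h.2 A hA hPA)⟩)
  obtain ⟨fi, hfim, hfii, hfi⟩ := exists_density_of_additive (P := P)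
    (fun A => RCLike.im (L (A.indicator fun _ => 1)))
    (fun A B hA hB hAB => by simp only [hunion A B hA hB hAB, map_add])
    (fun ε hε => (hac ε hε).imp fun δ h => ⟨h.1, fun A hA hPA =>
      (RCLike.abs_im_le_norm _).trans (h.2 A hA hPA)⟩)
  set Z : Ω → 𝕂 := fun ω => (fr ω : 𝕂) + (fi ω : 𝕂) * RCLike.I with hZ
  have hZm : Measurable Z := (RCLike.measurable_ofReal.comp hfrm).add
    ((RCLike.measurable_ofReal.comp hfim).mul_const _)
  have hZi : Integrable Z P := hfri.ofReal.add (hfii.ofReal.mul_const _)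
  have hind : ∀ A, MeasurableSet A → L (A.indicator fun _ => 1) = ∫ ω in A, Z ω ∂P := by
    intro A hA
    rw [hZ, integral_add (hfri.ofReal.mono_measure Measure.restrict_le_self)
      ((hfii.ofReal.mul_const _).mono_measure Measure.restrict_le_self),
      integral_mul_const, integral_ofReal, integral_ofReal, ← hfr A hA, ← hfi A hA,
      RCLike.re_add_im]
  have hsimple : ∀ s : SimpleFunc Ω 𝕂, L s = ∫ ω, Z ω * s ω ∂P := by
    intro s
    induction s using SimpleFunc.induction with
    | const c hs =>
      rename_i A
      have h1 : (⇑(SimpleFunc.piecewise A hs (SimpleFunc.const Ω c) (SimpleFunc.const Ω 0)) : Ω → 𝕂)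
          = c • A.indicator fun _ => 1 := by
        ext ω
        by_cases h : ω ∈ A <;> simp [h]
      rw [h1, hsmul c _ (hone A hs), hind A hs, ← integral_const_mul, ← integral_indicator hs]
      refine integral_congr_ae (Filter.Eventually.of_forall fun ω => ?_)
      by_cases h : ω ∈ A <;> simp [h, mul_comm]
    | add hd hf hg =>
      rename_i f g
      rw [SimpleFunc.coe_add, hadd _ _ (bddMeas_simpleFunc f) (bddMeas_simpleFunc g), hf, hg,
        ← integral_add ((bddMeas_simpleFunc f).integrable_mul hZi)
          ((bddMeas_simpleFunc g).integrable_mul hZi)]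
      simp only [Pi.add_apply, mul_add]
  refine ⟨Z, hZm, hZi, fun f hf => ?_⟩
  rw [← sub_eq_zero, ← norm_le_zero_iff]
  have hK0 : 0 ≤ K := by
    simpa using (norm_nonneg _).trans (hbd (fun _ => 0) 1 measurable_const (by simp))
  have hI0 : 0 ≤ ∫ ω, ‖Z ω‖ ∂P := integral_nonneg fun _ => norm_nonneg _
  set D := K + ∫ ω, ‖Z ω‖ ∂P + 1 with hD
  have hD0 : 0 < D := by positivity
  refine le_of_forall_pos_le_add fun η hη => ?_
  obtain ⟨C, hC⟩ := hf.2
  obtain ⟨s, hs⟩ := exists_simpleFunc_norm_sub_le hf.1 hC (div_pos hη hD0)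
  have hfs := hf.sub (bddMeas_simpleFunc s)
  have h1 : L f = L (f - s) + L s := by
    rw [← hadd _ _ hfs (bddMeas_simpleFunc s), sub_add_cancel]
  have h2 : ∫ ω, Z ω * f ω ∂P = ∫ ω, Z ω * (f - s) ω ∂P + ∫ ω, Z ω * s ω ∂P := by
    rw [← integral_add (hfs.integrable_mul hZi) ((bddMeas_simpleFunc s).integrable_mul hZi)]
    refine integral_congr_ae (Filter.Eventually.of_forall fun ω => ?_)
    simp only [Pi.sub_apply]
    ring
  have h3 : ‖L (f - s)‖ ≤ K * (η / D) := hbd _ _ hfs.1 hs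
  have h4 : ‖∫ ω, Z ω * (f - s) ω ∂P‖ ≤ (∫ ω, ‖Z ω‖ ∂P) * (η / D) := by
    rw [← integral_mul_const]
    refine norm_integral_le_of_norm_le (hZi.norm.mul_const _)
      (Filter.Eventually.of_forall fun ω => ?_)
    rw [norm_mul]
    exact mul_le_mul_of_nonneg_left (hs ω) (norm_nonneg _)
  have h5 : L f - ∫ ω, Z ω * f ω ∂P = L (f - s) - ∫ ω, Z ω * (f - s) ω ∂P := by
    rw [h1, h2, hsimple s]
    ring
  rw [h5, zero_add]
  calc _ ≤ K * (η / D) + (∫ ω, ‖Z ω‖ ∂P) * (η / D) := (norm_sub_le _ _).trans (add_le_add h3 h4)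
    _ ≤ D * (η / D) := by
        rw [← add_mul]
        have : 0 ≤ η / D := by positivity
        gcongr
        linarith
    _ = η := mul_div_cancel₀ _ hD0.ne'

lemma exists_nat_measure_lt {P : Measure Ω} [IsFiniteMeasure P] {f : Ω → ℝ} (hf : Measurable f)
    {δ : ℝ≥0∞} (hδ : 0 < δ) : ∃ n : ℕ, P {ω | (n : ℝ) < f ω} < δ := by
  have h := tendsto_measure_iInter_atTop (μ := P) (s := fun n : ℕ => {ω | (n : ℝ) < f ω})
    (fun n => (measurableSet_lt measurable_const hf).nullMeasurableSet)
    (fun a b hab ω (hω : (b : ℝ) < f ω) =>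
      show (a : ℝ) < f ω from (Nat.cast_le.2 hab).trans_lt hω) ⟨0, measure_ne_top _ _⟩
  have h0 : (⋂ n : ℕ, {ω | (n : ℝ) < f ω}) = ∅ := by
    ext ω
    simp only [Set.mem_iInter, Set.mem_empty_iff_false, iff_false, not_forall]
    obtain ⟨n, hn⟩ := exists_nat_ge (f ω)
    exact ⟨n, not_lt.2 hn⟩
  rw [h0, measure_empty] at h
  exact (h.eventually (gt_mem_nhds hδ)).exists

/-- The map `T` realizes the normed space `E` as the space `L_σ^p(P)`. -/
structure RealizesLsigma (P : Measure Ω) (σ : ℝ → ℝ) (p : ℝ) {E : Type*} [NormedAddCommGroup E]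
    [NormedSpace 𝕂 E] (T : E → Ω → 𝕂) : Prop where
  add : ∀ e₁ e₂ : E, T (e₁ + e₂) =ᵐ[P] T e₁ + T e₂
  smul : ∀ (c : 𝕂) (e : E), T (c • e) =ᵐ[P] c • T e
  mem : ∀ e : E, MemLsigma P σ p (T e)
  norm_eq : ∀ e : E, ENNReal.ofReal ‖e‖ = sigmaNorm P σ p (T e)
  surj : ∀ Y : Ω → 𝕂, MemLsigma P σ p Y → ∃ e : E, T e =ᵐ[P] Y

open Classical in
/-- The element of `E` represented by the random variable `Y`, or `0` if there is none. -/
def liftLsigma (P : Measure Ω) {E : Type*} [Zero E] (T : E → Ω → 𝕂) (Y : Ω → 𝕂) : E :=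
  if h : ∃ e : E, T e =ᵐ[P] Y then h.choose else 0

/-- Multiplication by the indicator function of `A`. -/
def cutLsigma (P : Measure Ω) {E : Type*} [Zero E] (T : E → Ω → 𝕂) (A : Set Ω) (e : E) : E :=
  liftLsigma P T (A.indicator (T e))

namespace RealizesLsigma

variable {P : Measure Ω} {σ : ℝ → ℝ} {p : ℝ} {E : Type*} [NormedAddCommGroup E]
  [NormedSpace 𝕂 E] {T : E → Ω → 𝕂}

lemma sigmaPow_eq (h : RealizesLsigma P σ p T) (hp : 0 < p) (e : E) :
    sigmaPow P σ p (T e) = ENNReal.ofReal ‖e‖ ^ p := by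
  rw [h.norm_eq e, sigmaNorm, ← ENNReal.rpow_mul, one_div, inv_mul_cancel₀ hp.ne',
    ENNReal.rpow_one]

lemma norm_le_of_sigmaPow_le (h : RealizesLsigma P σ p T) (hp : 0 < p) {e : E} {c : ℝ}
    (hc : 0 ≤ c) (he : sigmaPow P σ p (T e) ≤ ENNReal.ofReal c ^ p) : ‖e‖ ≤ c := by
  rw [h.sigmaPow_eq hp, ENNReal.rpow_le_rpow_iff hp] at he
  exact (ENNReal.ofReal_le_ofReal_iff hc).1 he

lemma ext (h : RealizesLsigma P σ p T) (hp : 0 < p) {e e' : E} (he : T e =ᵐ[P] T e') :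
    e = e' := by
  rw [← sub_eq_zero, ← norm_le_zero_iff]
  refine h.norm_le_of_sigmaPow_le hp le_rfl ?_
  have h0 : T (e - e') =ᵐ[P] fun _ => 0 := by
    have : e - e' = e + (-1 : 𝕂) • e' := by rw [neg_one_smul, sub_eq_add_neg]
    rw [this]
    filter_upwards [h.add e ((-1 : 𝕂) • e'), h.smul (-1) e', he] with ω h1 h2 h3
    rw [h1, Pi.add_apply, h2, Pi.smul_apply, h3]
    simp
  rw [sigmaPow_congr h0]
  simp [sigmaPow, ENNReal.zero_rpow_of_pos hp]

lemma lift_eq (h : RealizesLsigma P σ p T) (hp : 0 < p) {e : E} {Y : Ω → 𝕂} (he : T e =ᵐ[P] Y) :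
    liftLsigma P T Y = e := by
  have hex : ∃ e : E, T e =ᵐ[P] Y := ⟨e, he⟩
  rw [liftLsigma, dif_pos hex]
  exact h.ext hp (hex.choose_spec.trans he.symm)

lemma apply_lift (h : RealizesLsigma P σ p T) {Y : Ω → 𝕂} (hY : MemLsigma P σ p Y) :
    T (liftLsigma P T Y) =ᵐ[P] Y := by
  have hex := h.surj Y hY
  rw [liftLsigma, dif_pos hex]
  exact hex.choose_spec

lemma lift_add (h : RealizesLsigma P σ p T) (hp : 0 < p) {Y Y' : Ω → 𝕂}
    (hY : MemLsigma P σ p Y) (hY' : MemLsigma P σ p Y') :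
    liftLsigma P T (Y + Y') = liftLsigma P T Y + liftLsigma P T Y' :=
  h.lift_eq hp ((h.add _ _).trans ((h.apply_lift hY).add (h.apply_lift hY')))

lemma lift_smul (h : RealizesLsigma P σ p T) (hp : 0 < p) (c : 𝕂) {Y : Ω → 𝕂}
    (hY : MemLsigma P σ p Y) : liftLsigma P T (c • Y) = c • liftLsigma P T Y :=
  h.lift_eq hp ((h.smul _ _).trans ((h.apply_lift hY).const_smul c))

lemma mem_indicator (hp : 0 ≤ p) {Y : Ω → 𝕂} (hY : MemLsigma P σ p Y) {A : Set Ω}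
    (hA : MeasurableSet A) : MemLsigma P σ p (A.indicator Y) :=
  ⟨hY.1.indicator hA, (sigmaPow_mono hp fun ω => norm_indicator_le_norm_self Y ω).trans_lt hY.2⟩

lemma apply_cut (h : RealizesLsigma P σ p T) (hp : 0 ≤ p) {A : Set Ω} (hA : MeasurableSet A)
    (e : E) : T (cutLsigma P T A e) =ᵐ[P] A.indicator (T e) :=
  h.apply_lift (mem_indicator hp (h.mem e) hA)

lemma norm_cut_le (h : RealizesLsigma P σ p T) (hp : 0 < p) {A : Set Ω} (hA : MeasurableSet A)
    (e : E) : ‖cutLsigma P T A e‖ ≤ ‖e‖ := by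
  refine h.norm_le_of_sigmaPow_le hp (norm_nonneg _) ?_
  rw [sigmaPow_congr (h.apply_cut hp.le hA e), ← h.sigmaPow_eq hp]
  exact sigmaPow_mono hp.le fun ω => norm_indicator_le_norm_self _ ω

lemma cut_add_cut_compl (h : RealizesLsigma P σ p T) (hp : 0 < p) {A : Set Ω}
    (hA : MeasurableSet A) (e : E) : cutLsigma P T A e + cutLsigma P T Aᶜ e = e := by
  refine h.ext hp ?_
  filter_upwards [h.add (cutLsigma P T A e) (cutLsigma P T Aᶜ e), h.apply_cut hp.le hA e,
    h.apply_cut hp.le hA.compl e] with ω h1 h2 h3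
  rw [h1, Pi.add_apply, h2, h3, ← Pi.add_apply, Set.indicator_self_add_compl]

lemma cut_smul (h : RealizesLsigma P σ p T) (hp : 0 < p) {A : Set Ω} (hA : MeasurableSet A)
    (c : 𝕂) (e : E) : cutLsigma P T A (c • e) = c • cutLsigma P T A e := by
  refine h.ext hp ?_
  filter_upwards [h.apply_cut hp.le hA (c • e), h.smul c e, h.smul c (cutLsigma P T A e),
    h.apply_cut hp.le hA e] with ω h1 h2 h3 h4
  rw [h1, h3, Pi.smul_apply, h4]
  by_cases hω : ω ∈ A
  · simp [hω, h2]
  · simp [hω]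

lemma cut_sub (h : RealizesLsigma P σ p T) (hp : 0 < p) {A : Set Ω} (hA : MeasurableSet A)
    (e e' : E) : cutLsigma P T A (e - e') = cutLsigma P T A e - cutLsigma P T A e' := by
  rw [eq_sub_iff_add_eq]
  refine h.ext hp ?_
  have h5 := h.add (e - e') e'
  rw [sub_add_cancel] at h5
  filter_upwards [h.add (cutLsigma P T A (e - e')) (cutLsigma P T A e'),
    h.apply_cut hp.le hA (e - e'), h.apply_cut hp.le hA e', h.apply_cut hp.le hA e, h5]
    with ω h1 h2 h3 h4 h5
  rw [h1, h4, Pi.add_apply, h2, h3]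
  by_cases hω : ω ∈ A
  · simp [hω, h5]
  · simp [hω]

lemma cut_cut (h : RealizesLsigma P σ p T) (hp : 0 < p) {A B : Set Ω} (hA : MeasurableSet A)
    (hB : MeasurableSet B) (e : E) :
    cutLsigma P T A (cutLsigma P T B e) = cutLsigma P T (A ∩ B) e := by
  refine h.ext hp ?_
  filter_upwards [h.apply_cut hp.le hA (cutLsigma P T B e), h.apply_cut hp.le hB e,
    h.apply_cut hp.le (hA.inter hB) e] with ω h1 h2 h3
  rw [h1, h3, ← Set.indicator_indicator]
  by_cases hω : ω ∈ A
  · simp [hω, h2]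
  · simp [hω]

variable [IsProbabilityMeasure P]

lemma norm_cut_compl_add_cut_rpow_le (h : RealizesLsigma P σ p T) (hσ : IsDistortion σ)
    (hp : 0 < p) {A : Set Ω} (hA : MeasurableSet A) (x y : E) :
    ‖cutLsigma P T Aᶜ x + cutLsigma P T A y‖ ^ p ≤ ‖x‖ ^ p + ‖y‖ ^ p := by
  have h1 : T (cutLsigma P T Aᶜ x + cutLsigma P T A y)
      =ᵐ[P] Aᶜ.indicator (T x) + A.indicator (T y) :=
    (h.add _ _).trans ((h.apply_cut hp.le hA.compl x).add (h.apply_cut hp.le hA y))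
  have h2 := sigmaPow_add_le_of_disjoint hσ hp (Y := Aᶜ.indicator (T x)) (Y' := A.indicator (T y))
    ((h.mem x).1.indicator hA.compl) (fun ω => by by_cases hω : ω ∈ A <;> simp [hω])
  rw [← sigmaPow_congr h1, h.sigmaPow_eq hp] at h2
  have h3 := h2.trans (add_le_add
    (sigmaPow_mono hp.le fun ω => norm_indicator_le_norm_self (s := Aᶜ) (T x) ω)
    (sigmaPow_mono hp.le fun ω => norm_indicator_le_norm_self (s := A) (T y) ω))
  rw [h.sigmaPow_eq hp, h.sigmaPow_eq hp, ENNReal.ofReal_rpow_of_nonneg (norm_nonneg _) hp.le,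
    ENNReal.ofReal_rpow_of_nonneg (norm_nonneg _) hp.le,
    ENNReal.ofReal_rpow_of_nonneg (norm_nonneg _) hp.le,
    ← ENNReal.ofReal_add (by positivity) (by positivity)] at h3
  exact (ENNReal.ofReal_le_ofReal_iff (by positivity)).1 h3

lemma exists_norm_cut_le (h : RealizesLsigma P σ p T) (hrich : ∃ U : Ω → ℝ, IsUniformRV P U)
    (hσ : IsDistortion σ) (hp : 0 < p) (e : E) {ε : ℝ} (hε : 0 < ε) :
    ∃ δ > 0, ∀ A : Set Ω, MeasurableSet A → P A < δ → ‖cutLsigma P T A e‖ ≤ ε := by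
  have hε' : ENNReal.ofReal ε ^ p ≠ 0 :=
    (ENNReal.rpow_pos (ENNReal.ofReal_pos.2 hε) ENNReal.ofReal_ne_top).ne'
  obtain ⟨δ, hδ, hA⟩ := exists_sigmaPow_indicator_le hrich hσ hp (h.mem e) hε'
  refine ⟨δ, hδ, fun A hAm hPA => h.norm_le_of_sigmaPow_le hp hε.le ?_⟩
  rw [sigmaPow_congr (h.apply_cut hp.le hAm e)]
  exact hA A hAm hPA

/-- If `‖φ ∘ 1_A‖ ≤ c` for all events `A` of small probability, then also
`‖φ ∘ 1_A‖ ≤ 2^(1/p) / 2 * c` for all events `A` of small probability. -/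
lemma exists_norm_apply_cut_le_step (h : RealizesLsigma P σ p T)
    (hrich : ∃ U : Ω → ℝ, IsUniformRV P U) (hσ : IsDistortion σ) (hp : 0 < p)
    (φ : StrongDual 𝕂 E) {c : ℝ} (hc : 0 ≤ c)
    (hφ : ∃ δ > 0, ∀ A : Set Ω, MeasurableSet A → P A < δ →
      ∀ e, ‖φ (cutLsigma P T A e)‖ ≤ c * ‖e‖) :
    ∃ δ > 0, ∀ A : Set Ω, MeasurableSet A → P A < δ →
      ∀ e, ‖φ (cutLsigma P T A e)‖ ≤ (2 : ℝ) ^ (1 / p) / 2 * c * ‖e‖ := by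
  obtain ⟨δ₀, hδ₀, hφ⟩ := hφ
  set θ : ℝ := (2 : ℝ) ^ (1 / p) / 2 with hθ
  by_contra! hcon
  have key : ∀ δ > 0, ∃ A : Set Ω, MeasurableSet A ∧ P A < δ ∧ ∃ e : E, ‖e‖ ≤ 1 ∧
      ∃ r : ℝ, φ (cutLsigma P T A e) = r ∧ θ * c < r := by
    intro δ hδ
    obtain ⟨A, hA, hPA, e, he⟩ := hcon δ hδ
    set z := φ (cutLsigma P T A e) with hz
    have he0 : 0 < ‖e‖ := by
      by_contra! hle
      have h1 : ‖z‖ ≤ ‖φ‖ * ‖e‖ := (φ.le_opNorm _).trans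
        (mul_le_mul_of_nonneg_left (h.norm_cut_le hp hA e) (norm_nonneg _))
      have h2 : ‖e‖ = 0 := le_antisymm hle (norm_nonneg _)
      rw [h2, mul_zero] at h1 he
      linarith
    have hz0 : 0 < ‖z‖ := lt_of_le_of_lt (by positivity) he
    refine ⟨A, hA, hPA, ((starRingEnd 𝕂) z * ((‖z‖ * ‖e‖)⁻¹ : ℝ)) • e, ?_, ‖z‖ / ‖e‖, ?_, ?_⟩
    · rw [norm_smul, norm_mul, RCLike.norm_conj, RCLike.norm_ofReal, abs_of_nonneg (by positivity)]
      field_simp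
      exact le_rfl
    · rw [h.cut_smul hp hA, map_smul, smul_eq_mul, ← hz, mul_right_comm, mul_comm _ z,
        RCLike.mul_conj, ← RCLike.ofReal_pow, ← RCLike.ofReal_mul]
      congr 1
      field_simp
    · rw [lt_div_iff₀ he0]
      exact he
  obtain ⟨A, hA, hPA, x, hx, r, hr, hrc⟩ := key _ (ENNReal.half_pos hδ₀.ne')
  obtain ⟨δ₁, hδ₁, hcut⟩ := h.exists_norm_cut_le hrich hσ hp x
    (ε := (r - θ * c) / (‖φ‖ + 1)) (by have := norm_nonneg φ; apply div_pos <;> linarith)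
  obtain ⟨B, hB, hPB, y, hy, r', hr', hrc'⟩ := key _ (lt_min hδ₁ (ENNReal.half_pos hδ₀.ne'))
  set w := cutLsigma P T Bᶜ (cutLsigma P T A x) + cutLsigma P T B y with hw
  have hwnorm : ‖w‖ ≤ (2 : ℝ) ^ (1 / p) := by
    rw [one_div, Real.le_rpow_inv_iff_of_pos (norm_nonneg _) zero_le_two hp]
    refine (h.norm_cut_compl_add_cut_rpow_le hσ hp hB _ _).trans ?_
    have h1 : ‖cutLsigma P T A x‖ ^ p ≤ 1 :=
      Real.rpow_le_one (norm_nonneg _) ((h.norm_cut_le hp hA x).trans hx) hp.le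
    have h2 : ‖y‖ ^ p ≤ 1 := Real.rpow_le_one (norm_nonneg _) hy hp.le
    linarith
  have hwcut : cutLsigma P T (A ∪ B) w = w := by
    refine h.ext hp ?_
    filter_upwards [h.apply_cut hp.le (hA.union hB) w,
      h.add (cutLsigma P T Bᶜ (cutLsigma P T A x)) (cutLsigma P T B y),
      h.apply_cut hp.le hB.compl (cutLsigma P T A x), h.apply_cut hp.le hA x,
      h.apply_cut hp.le hB y] with ω h1 h2 h3 h4 h5
    rw [h1]
    by_cases hω : ω ∈ A ∪ B
    · rw [Set.indicator_of_mem hω]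
    · have hωA : ω ∉ A := fun hh => hω (Or.inl hh)
      have hωB : ω ∉ B := fun hh => hω (Or.inr hh)
      rw [Set.indicator_of_notMem hω, hw, h2, Pi.add_apply, h3, h5]
      simp [hωB, h4, hωA]
  have hPAB : P (A ∪ B) < δ₀ := by
    refine (measure_union_le _ _).trans_lt ?_
    rw [← ENNReal.add_halves δ₀]
    exact ENNReal.add_lt_add hPA (hPB.trans_le (min_le_right _ _))
  have hup : ‖φ w‖ ≤ c * (2 : ℝ) ^ (1 / p) := by
    have h1 := hφ _ (hA.union hB) hPAB w
    rw [hwcut] at h1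
    exact h1.trans (mul_le_mul_of_nonneg_left hwnorm hc)
  have hsmall : ‖φ (cutLsigma P T (B ∩ A) x)‖ ≤ r - θ * c := by
    have h1 := hcut (B ∩ A) (hB.inter hA)
      ((measure_mono Set.inter_subset_left).trans_lt (hPB.trans_le (min_le_left _ _)))
    have h2 : 0 ≤ r - θ * c := by linarith
    calc _ ≤ ‖φ‖ * ((r - θ * c) / (‖φ‖ + 1)) :=
          (φ.le_opNorm _).trans (mul_le_mul_of_nonneg_left h1 (norm_nonneg _))
      _ ≤ (‖φ‖ + 1) * ((r - θ * c) / (‖φ‖ + 1)) := by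
          have := norm_nonneg φ
          gcongr
          linarith
      _ = r - θ * c := mul_div_cancel₀ _ (by have := norm_nonneg φ; positivity)
  have hφw : φ w = (r : 𝕂) + r' - φ (cutLsigma P T (B ∩ A) x) := by
    have h1 := h.cut_add_cut_compl hp hB (cutLsigma P T A x)
    rw [h.cut_cut hp hB hA] at h1
    rw [hw, map_add, hr', ← hr, ← h1, map_add]
    rw [h1]
    ring
  have hlow : r + r' - (r - θ * c) ≤ ‖φ w‖ := by
    refine le_trans ?_ (RCLike.re_le_norm (φ w))
    rw [hφw]
    simp only [map_sub, map_add, RCLike.ofReal_re]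
    linarith [RCLike.re_le_norm (φ (cutLsigma P T (B ∩ A) x))]
  have : θ * c * 2 = c * (2 : ℝ) ^ (1 / p) := by
    rw [hθ]
    ring
  linarith

/-- The norm of the dual space is absolutely continuous. -/
lemma exists_norm_apply_cut_le (h : RealizesLsigma P σ p T)
    (hrich : ∃ U : Ω → ℝ, IsUniformRV P U) (hσ : IsDistortion σ) (hp : 1 < p)
    (φ : StrongDual 𝕂 E) {ε : ℝ} (hε : 0 < ε) :
    ∃ δ > 0, ∀ A : Set Ω, MeasurableSet A → P A < δ →
      ∀ e, ‖φ (cutLsigma P T A e)‖ ≤ ε * ‖e‖ := by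
  have hp0 : 0 < p := by linarith
  set θ : ℝ := (2 : ℝ) ^ (1 / p) / 2 with hθ
  have hθ0 : 0 ≤ θ := by positivity
  have hθ1 : θ < 1 := by
    have : (2 : ℝ) ^ (1 / p) < 2 ^ (1 : ℝ) :=
      Real.rpow_lt_rpow_of_exponent_lt one_lt_two ((div_lt_one hp0).2 hp)
    rw [Real.rpow_one] at this
    rw [hθ]
    linarith
  have hn : ∀ n : ℕ, ∃ δ > 0, ∀ A : Set Ω, MeasurableSet A → P A < δ →
      ∀ e, ‖φ (cutLsigma P T A e)‖ ≤ θ ^ n * ‖φ‖ * ‖e‖ := by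
    intro n
    induction n with
    | zero =>
      refine ⟨1, one_pos, fun A hA _ e => ?_⟩
      rw [pow_zero, one_mul]
      exact (φ.le_opNorm _).trans
        (mul_le_mul_of_nonneg_left (h.norm_cut_le hp0 hA e) (norm_nonneg _))
    | succ n ih =>
      have := h.exists_norm_apply_cut_le_step hrich hσ hp0 φ (by positivity) ih
      rw [pow_succ']
      simpa only [mul_assoc] using this
  have hlim : Filter.Tendsto (fun n : ℕ => θ ^ n * ‖φ‖) Filter.atTop (nhds (0 * ‖φ‖)) :=
    (tendsto_pow_atTop_nhds_zero_of_lt_one hθ0 hθ1).mul_const _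
  rw [zero_mul] at hlim
  obtain ⟨n, hnε⟩ := (hlim.eventually (gt_mem_nhds hε)).exists
  obtain ⟨δ, hδ, hA⟩ := hn n
  exact ⟨δ, hδ, fun A hAm hPA e => (hA A hAm hPA e).trans
    (mul_le_mul_of_nonneg_right hnε.le (norm_nonneg _))⟩

lemma sigmaPow_le_of_norm_le (hσ : IsDistortion σ) (hp : 0 ≤ p) {f : Ω → 𝕂} {C : ℝ}
    (hC : ∀ ω, ‖f ω‖ ≤ C) : sigmaPow P σ p f ≤ ENNReal.ofReal C ^ p := by
  have : ∀ ω, ‖f ω‖₊ ≤ C.toNNReal := fun ω => by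
    rw [← NNReal.coe_le_coe, coe_nnnorm]
    exact (hC ω).trans (Real.le_coe_toNNReal C)
  exact sigmaPow_le_of_bound hσ hp this

lemma memLsigma_of_bddMeas (hσ : IsDistortion σ) (hp : 0 ≤ p) {f : Ω → 𝕂} (hf : BddMeas f) :
    MemLsigma P σ p f := by
  obtain ⟨hf, C, hC⟩ := hf
  exact ⟨hf.aestronglyMeasurable, (sigmaPow_le_of_norm_le hσ hp hC).trans_lt
    (ENNReal.rpow_lt_top_of_nonneg hp ENNReal.ofReal_ne_top)⟩

lemma norm_lift_le (h : RealizesLsigma P σ p T) (hσ : IsDistortion σ) (hp : 0 < p) {f : Ω → 𝕂}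
    (hf : Measurable f) {C : ℝ} (hC : ∀ ω, ‖f ω‖ ≤ C) : ‖liftLsigma P T f‖ ≤ C := by
  have hC0 : 0 ≤ C := by
    obtain ⟨ω⟩ := nonempty_of_isProbabilityMeasure P
    exact (norm_nonneg _).trans (hC ω)
  refine h.norm_le_of_sigmaPow_le hp hC0 ?_
  rw [sigmaPow_congr (h.apply_lift (memLsigma_of_bddMeas hσ hp.le ⟨hf, C, hC⟩))]
  exact sigmaPow_le_of_norm_le hσ hp.le hC

lemma lintegral_enorm_le (h : RealizesLsigma P σ p T) (hrich : ∃ U : Ω → ℝ, IsUniformRV P U)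
    (hσ : IsDistortion σ) (hp : 1 ≤ p) (e : E) :
    ∫⁻ ω, ‖T e ω‖ₑ ∂P ≤ 3 * ENNReal.ofReal ‖e‖ := by
  have hp0 : 0 < p := by linarith
  have hunit : ∀ e : E, ‖e‖ ≤ 1 → ∫⁻ ω, ‖T e ω‖ₑ ∂P ≤ 3 := by
    intro e he
    have h1 : ∀ x : ℝ≥0∞, x ≤ 1 + x ^ p := by
      intro x
      rcases le_total x 1 with hx | hx
      · exact hx.trans le_self_add
      · calc x = x ^ (1 : ℝ) := (ENNReal.rpow_one x).symm
          _ ≤ x ^ p := ENNReal.rpow_le_rpow_of_exponent_le hx hp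
          _ ≤ 1 + x ^ p := le_add_self
    calc ∫⁻ ω, ‖T e ω‖ₑ ∂P ≤ ∫⁻ ω, 1 + (‖T e ω‖₊ : ℝ≥0∞) ^ p ∂P :=
          lintegral_mono fun ω => h1 _
      _ = 1 + ∫⁻ ω, (‖T e ω‖₊ : ℝ≥0∞) ^ p ∂P := by
          rw [lintegral_add_left measurable_const]
          simp
      _ ≤ 1 + (sigmaPow P σ p (T e) + 1) := by
          gcongr
          exact lintegral_rpow_le_sigmaPow_add_one hrich hσ hp0.le (h.mem e).1
      _ ≤ 1 + (1 + 1) := by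
          gcongr
          rw [h.sigmaPow_eq hp0]
          exact ENNReal.rpow_le_one (ENNReal.ofReal_le_one.2 he) hp0.le
      _ = 3 := by norm_num
  have hdec : ((‖e‖ : ℝ) : 𝕂) • ((‖e‖⁻¹ : ℝ) : 𝕂) • e = e := by
    rcases eq_or_ne e 0 with rfl | he
    · simp
    · rw [smul_smul, ← RCLike.ofReal_mul, mul_inv_cancel₀ (norm_ne_zero_iff.2 he),
        RCLike.ofReal_one, one_smul]
  have hle : ‖((‖e‖⁻¹ : ℝ) : 𝕂) • e‖ ≤ 1 := by
    rw [norm_smul, RCLike.norm_ofReal, abs_of_nonneg (by positivity)]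
    exact inv_mul_le_one
  have hae := h.smul ((‖e‖ : ℝ) : 𝕂) (((‖e‖⁻¹ : ℝ) : 𝕂) • e)
  rw [hdec] at hae
  calc ∫⁻ ω, ‖T e ω‖ₑ ∂P = ∫⁻ ω, ENNReal.ofReal ‖e‖ * ‖T (((‖e‖⁻¹ : ℝ) : 𝕂) • e) ω‖ₑ ∂P := by
        refine lintegral_congr_ae ?_
        filter_upwards [hae] with ω hω
        rw [hω, Pi.smul_apply, enorm_smul, ← ofReal_norm ((‖e‖ : ℝ) : 𝕂),
          RCLike.norm_ofReal, abs_norm]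
    _ = ENNReal.ofReal ‖e‖ * ∫⁻ ω, ‖T (((‖e‖⁻¹ : ℝ) : 𝕂) • e) ω‖ₑ ∂P :=
        lintegral_const_mul' _ _ ENNReal.ofReal_ne_top
    _ ≤ 3 * ENNReal.ofReal ‖e‖ := by
        rw [mul_comm]
        exact mul_le_mul_left (hunit _ hle) _

lemma integrable (h : RealizesLsigma P σ p T) (hrich : ∃ U : Ω → ℝ, IsUniformRV P U)
    (hσ : IsDistortion σ) (hp : 1 ≤ p) (e : E) : Integrable (T e) P :=
  ⟨(h.mem e).1, (h.lintegral_enorm_le hrich hσ hp e).trans_lt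
    (ENNReal.mul_lt_top (by simp) ENNReal.ofReal_lt_top)⟩

lemma integral_norm_le (h : RealizesLsigma P σ p T) (hrich : ∃ U : Ω → ℝ, IsUniformRV P U)
    (hσ : IsDistortion σ) (hp : 1 ≤ p) (e : E) : ∫ ω, ‖T e ω‖ ∂P ≤ 3 * ‖e‖ := by
  rw [integral_norm_eq_lintegral_enorm (h.mem e).1]
  refine ENNReal.toReal_le_of_le_ofReal (by positivity) ?_
  rw [ENNReal.ofReal_mul (by norm_num)]
  simpa using h.lintegral_enorm_le hrich hσ hp e

/-- Bounded random variables act as continuous functionals. -/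
lemma exists_functional (h : RealizesLsigma P σ p T) (hrich : ∃ U : Ω → ℝ, IsUniformRV P U)
    (hσ : IsDistortion σ) (hp : 1 ≤ p) {Z : Ω → 𝕂} (hZ : BddMeas Z) :
    ∃ ψ : StrongDual 𝕂 E, (∀ e, ψ e = ∫ ω, Z ω * T e ω ∂P) ∧
      ∀ C : ℝ, (∀ ω, ‖Z ω‖ ≤ C) → ‖ψ‖ ≤ 3 * C := by
  have hint : ∀ e, Integrable (fun ω => Z ω * T e ω) P := fun e => by
    simpa only [mul_comm] using hZ.integrable_mul (h.integrable hrich hσ hp e)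
  let l : E →ₗ[𝕂] 𝕂 :=
    { toFun := fun e => ∫ ω, Z ω * T e ω ∂P
      map_add' := fun e e' => by
        rw [← integral_add (hint e) (hint e')]
        refine integral_congr_ae ?_
        filter_upwards [h.add e e'] with ω hω
        rw [hω, Pi.add_apply, mul_add]
      map_smul' := fun c e => by
        rw [RingHom.id_apply, ← integral_smul]
        refine integral_congr_ae ?_
        filter_upwards [h.smul c e] with ω hω
        rw [hω, Pi.smul_apply, smul_eq_mul, smul_eq_mul]
        ring }
  have hl : ∀ C : ℝ, (∀ ω, ‖Z ω‖ ≤ C) → ∀ e, ‖l e‖ ≤ 3 * C * ‖e‖ := by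
    intro C hC e
    have hC0 : 0 ≤ C := by
      obtain ⟨ω⟩ := nonempty_of_isProbabilityMeasure P
      exact (norm_nonneg _).trans (hC ω)
    calc ‖l e‖ ≤ ∫ ω, C * ‖T e ω‖ ∂P := by
          refine norm_integral_le_of_norm_le ((h.integrable hrich hσ hp e).norm.const_mul C)
            (Filter.Eventually.of_forall fun ω => ?_)
          rw [norm_mul]
          exact mul_le_mul_of_nonneg_right (hC ω) (norm_nonneg _)
      _ = C * ∫ ω, ‖T e ω‖ ∂P := integral_const_mul _ _
      _ ≤ C * (3 * ‖e‖) := mul_le_mul_of_nonneg_left (h.integral_norm_le hrich hσ hp e) hC0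
      _ = 3 * C * ‖e‖ := by ring
  obtain ⟨C, hC⟩ := hZ.2
  refine ⟨l.mkContinuous (3 * C) (hl C hC), fun e => rfl, fun D hD => ?_⟩
  refine ContinuousLinearMap.opNorm_le_bound _ ?_ (hl D hD)
  obtain ⟨ω⟩ := nonempty_of_isProbabilityMeasure P
  exact mul_nonneg (by norm_num) ((norm_nonneg _).trans (hD ω))

/-- Bounded random variables are dense in `L_σ^p(P)`. -/
lemma exists_bddMeas_norm_sub_lift_le (h : RealizesLsigma P σ p T)
    (hrich : ∃ U : Ω → ℝ, IsUniformRV P U) (hσ : IsDistortion σ) (hp : 0 < p) (e : E) {ε : ℝ}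
    (hε : 0 < ε) : ∃ f : Ω → 𝕂, BddMeas f ∧ ‖e - liftLsigma P T f‖ ≤ ε := by
  obtain ⟨δ, hδ, hcut⟩ := h.exists_norm_cut_le hrich hσ hp e hε
  obtain ⟨Y, hYm, hY⟩ := (h.mem e).1.aemeasurable
  obtain ⟨n, hn⟩ := exists_nat_measure_lt (P := P) hYm.norm hδ
  set A : Set Ω := {ω | (n : ℝ) < ‖Y ω‖} with hA
  have hAm : MeasurableSet A := measurableSet_lt measurable_const hYm.norm
  have hf : BddMeas (Aᶜ.indicator Y) := by
    refine ⟨hYm.indicator hAm.compl, n, fun ω => ?_⟩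
    by_cases hω : ω ∈ A
    · simp [hω]
    · rw [Set.indicator_of_mem (show ω ∈ Aᶜ from hω)]
      exact not_lt.1 hω
  refine ⟨_, hf, ?_⟩
  have hl : liftLsigma P T (Aᶜ.indicator Y) = cutLsigma P T Aᶜ e := by
    refine h.lift_eq hp ((h.apply_cut hp.le hAm.compl e).trans ?_)
    filter_upwards [hY] with ω hω
    by_cases hωA : ω ∈ A <;> simp [hωA, hω]
  rw [hl, sub_eq_of_eq_add (h.cut_add_cut_compl hp hAm e).symm]
  exact hcut A hAm hn

/-- Bounded random variables are dense in the dual of `L_σ^p(P)`. -/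
lemma exists_bddMeas_norm_sub_functional_le (h : RealizesLsigma P σ p T)
    (hrich : ∃ U : Ω → ℝ, IsUniformRV P U) (hσ : IsDistortion σ) (hp : 1 < p)
    (φ : StrongDual 𝕂 E) {ε : ℝ} (hε : 0 < ε) :
    ∃ Z : Ω → 𝕂, BddMeas Z ∧ ∀ ψ : StrongDual 𝕂 E, (∀ e, ψ e = ∫ ω, Z ω * T e ω ∂P) →
      ‖φ - ψ‖ ≤ ε := by
  have hp0 : 0 < p := by linarith
  have hmem : ∀ {f : Ω → 𝕂}, BddMeas f → MemLsigma P σ p f := memLsigma_of_bddMeas hσ hp0.le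
  have hcutl : ∀ {A : Set Ω} {f : Ω → 𝕂}, MeasurableSet A → BddMeas f →
      cutLsigma P T A (liftLsigma P T f) = liftLsigma P T (A.indicator f) := by
    intro A f hA hf
    refine (h.lift_eq hp0 ((h.apply_cut hp0.le hA _).trans ?_)).symm
    filter_upwards [h.apply_lift (hmem hf)] with ω hω
    by_cases hωA : ω ∈ A <;> simp [hωA, hω]
  obtain ⟨Z, hZm, hZi, hZ⟩ := exists_density_of_functional (P := P)
    (fun f => φ (liftLsigma P T f))
    (fun f g hf hg => by rw [h.lift_add hp0 (hmem hf) (hmem hg), map_add])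
    (fun c f hf => by rw [h.lift_smul hp0 c (hmem hf), map_smul, smul_eq_mul])
    (K := ‖φ‖) (fun f C hf hC => (φ.le_opNorm _).trans
      (mul_le_mul_of_nonneg_left (h.norm_lift_le hσ hp0 hf hC) (norm_nonneg _)))
    (fun η hη => by
      obtain ⟨δ, hδ, hA⟩ := h.exists_norm_apply_cut_le hrich hσ hp φ hη
      refine ⟨δ, hδ, fun A hAm hPA => ?_⟩
      rw [← hcutl hAm (bddMeas_const 1)]
      refine (hA A hAm hPA _).trans ?_
      have := h.norm_lift_le (f := fun _ => (1 : 𝕂)) hσ hp0 measurable_const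
        (fun ω => norm_one.le)
      nlinarith)
  obtain ⟨δ, hδ, hcut⟩ := h.exists_norm_apply_cut_le hrich hσ hp φ hε
  obtain ⟨n, hn⟩ := exists_nat_measure_lt (P := P) hZm.norm hδ
  set A : Set Ω := {ω | (n : ℝ) < ‖Z ω‖} with hA
  have hAm : MeasurableSet A := measurableSet_lt measurable_const hZm.norm
  have hZn : BddMeas (Aᶜ.indicator Z) := by
    refine ⟨hZm.indicator hAm.compl, n, fun ω => ?_⟩
    by_cases hω : ω ∈ A
    · simp [hω]
    · rw [Set.indicator_of_mem (show ω ∈ Aᶜ from hω)]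
      exact not_lt.1 hω
  refine ⟨_, hZn, fun ψ hψ => ?_⟩
  have hlift : ∀ f : Ω → 𝕂, BddMeas f →
      φ (cutLsigma P T Aᶜ (liftLsigma P T f)) = ψ (liftLsigma P T f) := by
    intro f hf
    rw [hcutl hAm.compl hf, hZ _ (hf.indicator hAm.compl), hψ]
    refine integral_congr_ae ?_
    filter_upwards [h.apply_lift (hmem hf)] with ω hω
    rw [hω]
    by_cases hωA : ω ∈ A <;> simp [hωA]
  have hall : ∀ e, φ (cutLsigma P T Aᶜ e) = ψ e := by
    intro e
    rw [← sub_eq_zero, ← norm_le_zero_iff]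
    refine le_of_forall_pos_le_add fun η hη => ?_
    rw [zero_add]
    have hK : 0 < ‖φ‖ + ‖ψ‖ + 1 := by positivity
    obtain ⟨f, hf, hfe⟩ := h.exists_bddMeas_norm_sub_lift_le hrich hσ hp0 e (div_pos hη hK)
    set g := liftLsigma P T f
    have h1 : φ (cutLsigma P T Aᶜ e) - ψ e = φ (cutLsigma P T Aᶜ (e - g)) - ψ (e - g) := by
      rw [h.cut_sub hp0 hAm.compl, map_sub, map_sub, hlift f hf]
      ring
    rw [h1]
    calc _ ≤ ‖φ‖ * ‖e - g‖ + ‖ψ‖ * ‖e - g‖ := by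
          refine (norm_sub_le _ _).trans (add_le_add ?_ (ψ.le_opNorm _))
          exact (φ.le_opNorm _).trans
            (mul_le_mul_of_nonneg_left (h.norm_cut_le hp0 hAm.compl _) (norm_nonneg _))
      _ ≤ (‖φ‖ + ‖ψ‖ + 1) * ‖e - g‖ := by nlinarith [norm_nonneg (e - g)]
      _ ≤ (‖φ‖ + ‖ψ‖ + 1) * (η / (‖φ‖ + ‖ψ‖ + 1)) := by gcongr
      _ = η := mul_div_cancel₀ _ hK.ne'
  refine ContinuousLinearMap.opNorm_le_bound _ hε.le fun e => ?_
  have h2 : (φ - ψ) e = φ (cutLsigma P T A e) := by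
    rw [sub_apply, ← hall e, sub_eq_iff_eq_add, ← map_add,
      h.cut_add_cut_compl hp0 hAm]
  rw [h2]
  exact hcut A hAm hn e

end RealizesLsigma

lemma rpow_sub_one_mul_le {p : ℝ} (hp : 1 < p) {ε y w : ℝ} (hε : 0 < ε) (hy : 0 ≤ y)
    (hw : 0 ≤ w) : y ^ (p - 1) * w ≤ ε * y ^ p + ε⁻¹ ^ (p - 1) * w ^ p := by
  have hmul : ∀ x : ℝ, 0 ≤ x → x ^ (p - 1) * x = x ^ p := fun x hx => by
    rw [← Real.rpow_add_one' hx (by linarith), sub_add_cancel]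
  rcases le_total w (ε * y) with hle | hle
  · calc y ^ (p - 1) * w ≤ y ^ (p - 1) * (ε * y) := by gcongr
      _ = ε * y ^ p := by rw [mul_left_comm, hmul y hy]
      _ ≤ ε * y ^ p + ε⁻¹ ^ (p - 1) * w ^ p := le_add_of_nonneg_right (by positivity)
  · have hyw : y ≤ ε⁻¹ * w := (le_inv_mul_iff₀ hε).2 hle
    calc y ^ (p - 1) * w ≤ (ε⁻¹ * w) ^ (p - 1) * w := by
          gcongr
      _ = ε⁻¹ ^ (p - 1) * w ^ p := by
          rw [Real.mul_rpow (by positivity) hw, mul_assoc, hmul w hw]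
      _ ≤ ε * y ^ p + ε⁻¹ ^ (p - 1) * w ^ p := le_add_of_nonneg_left (by positivity)

namespace RealizesLsigma

variable {P : Measure Ω} {σ : ℝ → ℝ} {p : ℝ} {E : Type*} [NormedAddCommGroup E]
  [NormedSpace 𝕂 E] {T : E → Ω → 𝕂}

variable [IsProbabilityMeasure P]

lemma norm_functional_le (h : RealizesLsigma P σ p T) (hp : 1 < p) {U : Ω → ℝ}
    (hU : IsUniformRV P U) {d : Ω → ℝ} (hd0 : ∀ ω, 0 ≤ d ω)
    (hd : ∀ ω, ENNReal.ofReal (d ω) ≤ distortionExt σ (U ω)) {W Z : Ω → 𝕂}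
    (hW : Integrable (fun ω => d ω * ‖W ω‖ ^ p) P)
    (hZ : ∀ ω, ‖Z ω‖ = d ω * ‖W ω‖ ^ (p - 1)) {ψ : StrongDual 𝕂 E}
    (hψ : ∀ e, ψ e = ∫ ω, Z ω * T e ω ∂P) {ε : ℝ} (hε : 0 < ε) :
    ‖ψ‖ ≤ ε * ∫ ω, d ω * ‖W ω‖ ^ p ∂P + ε⁻¹ ^ (p - 1) := by
  have hp0 : 0 < p := by linarith
  have hdW : ∀ ω, 0 ≤ d ω * ‖W ω‖ ^ p := fun ω => mul_nonneg (hd0 ω) (by positivity)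
  have ha : 0 ≤ ε * ∫ ω, d ω * ‖W ω‖ ^ p ∂P := mul_nonneg hε.le (integral_nonneg hdW)
  have hM : 0 ≤ ε⁻¹ ^ (p - 1) := by positivity
  refine ContinuousLinearMap.opNorm_le_of_unit_norm (add_nonneg ha hM) fun e he => ?_
  rw [← ENNReal.ofReal_le_ofReal_iff (add_nonneg ha hM), ofReal_norm, hψ]
  have hTe : ∫⁻ ω, ENNReal.ofReal (d ω) * (‖T e ω‖₊ : ℝ≥0∞) ^ p ∂P ≤ 1 := by
    calc _ ≤ ∫⁻ ω, ENNReal.ofReal (σ (U ω)) * (‖T e ω‖₊ : ℝ≥0∞) ^ p ∂P := by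
          refine lintegral_mono_ae ?_
          filter_upwards [hU.ae_eq_ext σ] with ω hω
          rw [hω]
          gcongr
          exact hd ω
      _ ≤ sigmaPow P σ p (T e) := hU.lintegral_le_sigmaPow _
      _ = 1 := by rw [h.sigmaPow_eq hp0, he, ENNReal.ofReal_one, ENNReal.one_rpow]
  have hpt : ∀ ω, ‖Z ω * T e ω‖ₑ ≤ ENNReal.ofReal (ε * (d ω * ‖W ω‖ ^ p))
      + ENNReal.ofReal (ε⁻¹ ^ (p - 1)) * (ENNReal.ofReal (d ω) * (‖T e ω‖₊ : ℝ≥0∞) ^ p) := by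
    intro ω
    have h1 : (‖T e ω‖₊ : ℝ≥0∞) ^ p = ENNReal.ofReal (‖T e ω‖ ^ p) := by
      rw [← ENNReal.ofReal_rpow_of_nonneg (norm_nonneg _) hp0.le, ofReal_norm]
      rfl
    rw [h1, ← ENNReal.ofReal_mul (hd0 ω), ← ENNReal.ofReal_mul hM,
      ← ENNReal.ofReal_add (mul_nonneg hε.le (hdW ω))
        (mul_nonneg hM (mul_nonneg (hd0 ω) (by positivity))), ← ofReal_norm]
    refine ENNReal.ofReal_le_ofReal ?_
    rw [norm_mul, hZ]
    have h2 := mul_le_mul_of_nonneg_left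
      (rpow_sub_one_mul_le hp hε (norm_nonneg (W ω)) (norm_nonneg (T e ω))) (hd0 ω)
    linarith
  calc ‖∫ ω, Z ω * T e ω ∂P‖ₑ ≤ ∫⁻ ω, ‖Z ω * T e ω‖ₑ ∂P := enorm_integral_le_lintegral_enorm _
    _ ≤ _ := lintegral_mono hpt
    _ = ENNReal.ofReal (ε * ∫ ω, d ω * ‖W ω‖ ^ p ∂P) + ENNReal.ofReal (ε⁻¹ ^ (p - 1))
        * ∫⁻ ω, ENNReal.ofReal (d ω) * (‖T e ω‖₊ : ℝ≥0∞) ^ p ∂P := by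
        rw [lintegral_add_left' (hW.const_mul ε).aemeasurable.ennreal_ofReal,
          lintegral_const_mul' _ _ ENNReal.ofReal_ne_top, ← integral_const_mul,
          ofReal_integral_eq_lintegral_ofReal (hW.const_mul ε)
            (Filter.Eventually.of_forall fun ω => mul_nonneg hε.le (hdW ω))]
    _ ≤ ENNReal.ofReal (ε * ∫ ω, d ω * ‖W ω‖ ^ p ∂P) + ENNReal.ofReal (ε⁻¹ ^ (p - 1)) * 1 := by
        gcongr
    _ = _ := by rw [mul_one, ENNReal.ofReal_add ha hM]

/-- A random variable that represents a bounded functional on the dual of `L_σ^p(P)`, evaluated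
at bounded random variables, satisfies a norm bound. -/
lemma lintegral_le_of_pairing (h : RealizesLsigma P σ p T) (hσ : IsDistortion σ) (hp : 1 < p)
    {Φ : (Ω → 𝕂) → StrongDual 𝕂 E}
    (hΦ : ∀ Z, BddMeas Z → ∀ e, Φ Z e = ∫ ω, Z ω * T e ω ∂P)
    (Ψ : StrongDual 𝕂 (StrongDual 𝕂 E)) {Y : Ω → 𝕂} (hYm : Measurable Y)
    (hY : ∀ Z, BddMeas Z → Ψ (Φ Z) = ∫ ω, Y ω * Z ω ∂P) {U : Ω → ℝ} (hU : IsUniformRV P U) :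
    ∫⁻ ω, ENNReal.ofReal (σ (U ω)) * (‖Y ω‖₊ : ℝ≥0∞) ^ p ∂P
      ≤ ENNReal.ofReal (2 * ‖Ψ‖ * (2 * (‖Ψ‖ + 1)) ^ (p - 1)) := by
  have hp0 : 0 < p := by linarith
  set B := 2 * ‖Ψ‖ * (2 * (‖Ψ‖ + 1)) ^ (p - 1) with hB
  let d : ℕ → Ω → ℝ := fun n ω => (min (distortionExt σ (U ω)) n).toReal
  have hdtop : ∀ (n : ℕ) ω, min (distortionExt σ (U ω)) (n : ℝ≥0∞) ≠ ∞ := fun n ω =>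
    ne_top_of_le_ne_top (ENNReal.natCast_ne_top n) (min_le_right _ _)
  have hd0 : ∀ n ω, 0 ≤ d n ω := fun n ω => ENNReal.toReal_nonneg
  have hdof : ∀ n ω, ENNReal.ofReal (d n ω) = min (distortionExt σ (U ω)) n := fun n ω =>
    ENNReal.ofReal_toReal (hdtop n ω)
  have hdn : ∀ n ω, d n ω ≤ n := fun n ω => by
    refine ENNReal.toReal_le_of_le_ofReal (Nat.cast_nonneg n) ?_
    rw [ENNReal.ofReal_natCast]
    exact min_le_right _ _
  have hdm : ∀ n, Measurable (d n) := fun n =>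
    ((hU.measurable_ext hσ).min measurable_const).ennreal_toReal
  let A : ℕ → Set Ω := fun n => {ω | ‖Y ω‖ ≤ n}
  have hA : ∀ n, MeasurableSet (A n) := fun n => measurableSet_le hYm.norm measurable_const
  let W : ℕ → Ω → 𝕂 := fun n => (A n).indicator Y
  have hWm : ∀ n, Measurable (W n) := fun n => hYm.indicator (hA n)
  have hWn : ∀ n ω, ‖W n ω‖ ≤ n := by
    intro n ω
    by_cases hω : ω ∈ A n
    · simp only [W, Set.indicator_of_mem hω]
      exact hω
    · simp [W, hω]
  have hdW0 : ∀ n ω, 0 ≤ d n ω * ‖W n ω‖ ^ p := fun n ω => mul_nonneg (hd0 n ω) (by positivity)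
  have hdWm : ∀ n, Measurable fun ω => d n ω * ‖W n ω‖ ^ p := fun n =>
    (hdm n).mul ((hWm n).norm.pow_const p)
  have hdWi : ∀ n, Integrable (fun ω => d n ω * ‖W n ω‖ ^ p) P := by
    intro n
    refine Integrable.of_bound (hdWm n).aestronglyMeasurable (n * (n : ℝ) ^ p)
      (Filter.Eventually.of_forall fun ω => ?_)
    rw [Real.norm_of_nonneg (hdW0 n ω)]
    gcongr
    exacts [hdn n ω, hWn n ω]
  have hbound : ∀ n, ∫ ω, d n ω * ‖W n ω‖ ^ p ∂P ≤ B := by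
    intro n
    set a := ∫ ω, d n ω * ‖W n ω‖ ^ p ∂P with ha
    let Z : Ω → 𝕂 := fun ω =>
      ((d n ω * ‖W n ω‖ ^ (p - 2) : ℝ) : 𝕂) * (starRingEnd 𝕂) (W n ω)
    have hZnorm : ∀ ω, ‖Z ω‖ = d n ω * ‖W n ω‖ ^ (p - 1) := by
      intro ω
      rw [norm_mul, RCLike.norm_conj, RCLike.norm_ofReal,
        abs_of_nonneg (mul_nonneg (hd0 n ω) (by positivity)), mul_assoc,
        ← Real.rpow_add_one' (norm_nonneg _) (by linarith)]
      ring_nf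
    have hZ : BddMeas Z := by
      refine ⟨(RCLike.measurable_ofReal.comp ((hdm n).mul ((hWm n).norm.pow_const _))).mul
        (RCLike.continuous_conj.measurable.comp (hWm n)), n * (n : ℝ) ^ (p - 1), fun ω => ?_⟩
      rw [hZnorm]
      gcongr
      exacts [hdn n ω, hWn n ω]
    have hYZ : ∀ ω, Y ω * Z ω = ((d n ω * ‖W n ω‖ ^ p : ℝ) : 𝕂) := by
      intro ω
      have h1 : Y ω * Z ω = W n ω * Z ω := by
        by_cases hω : ω ∈ A n <;> simp [Z, W, hω]
      rw [h1, mul_left_comm, RCLike.mul_conj, ← RCLike.ofReal_pow, ← RCLike.ofReal_mul,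
        mul_assoc, ← Real.rpow_add_natCast' (norm_nonneg _) (by push_cast; linarith)]
      push_cast
      ring_nf
    have hΨa : Ψ (Φ Z) = (a : 𝕂) := by
      rw [hY Z hZ, ha, ← integral_ofReal]
      exact integral_congr_ae (Filter.Eventually.of_forall hYZ)
    have ha0 : 0 ≤ a := integral_nonneg (hdW0 n)
    have h2 : a ≤ ‖Ψ‖ * ‖Φ Z‖ := by
      have := Ψ.le_opNorm (Φ Z)
      rwa [hΨa, RCLike.norm_ofReal, abs_of_nonneg ha0] at this
    have hK : 0 < 2 * (‖Ψ‖ + 1) := by positivity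
    have h3 := h.norm_functional_le hp hU (hd0 n) (fun ω => (hdof n ω).trans_le (min_le_left _ _))
      (hdWi n) hZnorm (hΦ Z hZ) (inv_pos.2 hK)
    rw [inv_inv, ← ha] at h3
    have h4 : ‖Ψ‖ * ((2 * (‖Ψ‖ + 1))⁻¹ * a) ≤ a / 2 := by
      rw [← mul_assoc, ← div_eq_mul_inv, div_mul_eq_mul_div, div_le_div_iff₀ hK two_pos]
      nlinarith [norm_nonneg Ψ]
    have h5 := mul_le_mul_of_nonneg_left h3 (norm_nonneg Ψ)
    rw [mul_add] at h5
    rw [hB]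
    linarith
  have hlint : ∀ n, ∫⁻ ω, ENNReal.ofReal (d n ω * ‖W n ω‖ ^ p) ∂P ≤ ENNReal.ofReal B := by
    intro n
    rw [← ofReal_integral_eq_lintegral_ofReal (hdWi n) (Filter.Eventually.of_forall (hdW0 n))]
    exact ENNReal.ofReal_le_ofReal (hbound n)
  calc _ ≤ ∫⁻ ω, Filter.liminf (fun n => ENNReal.ofReal (d n ω * ‖W n ω‖ ^ p)) Filter.atTop ∂P := by
        refine lintegral_mono_ae ?_
        filter_upwards [hU.ae_eq_ext σ] with ω hω
        refine Filter.le_liminf_of_le (by isBoundedDefault) ?_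
        obtain ⟨N, hN⟩ := exists_nat_ge (max ‖Y ω‖ (σ (U ω)))
        filter_upwards [Filter.eventually_ge_atTop N] with n hn
        have hn' : (N : ℝ) ≤ n := Nat.cast_le.2 hn
        have hωA : ω ∈ A n := ((le_max_left _ _).trans hN).trans hn'
        have hmin : min (distortionExt σ (U ω)) (n : ℝ≥0∞) = distortionExt σ (U ω) := by
          refine min_eq_left ?_
          rw [← hω, ← ENNReal.ofReal_natCast]
          exact ENNReal.ofReal_le_ofReal (((le_max_right _ _).trans hN).trans hn')
        rw [ENNReal.ofReal_mul (hd0 n ω), hdof, hmin, ← hω]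
        simp only [W, Set.indicator_of_mem hωA]
        rw [← ENNReal.ofReal_rpow_of_nonneg (norm_nonneg _) hp0.le, ofReal_norm]
        exact le_rfl
    _ ≤ Filter.liminf (fun n => ∫⁻ ω, ENNReal.ofReal (d n ω * ‖W n ω‖ ^ p) ∂P) Filter.atTop :=
        lintegral_liminf_le fun n => (hdWm n).ennreal_ofReal
    _ ≤ ENNReal.ofReal B :=
        Filter.liminf_le_of_le (by isBoundedDefault) fun b hb => by
          obtain ⟨n, hn⟩ := hb.exists
          exact hn.trans (hlint n)

theorem surjective_inclusionInDoubleDual (h : RealizesLsigma P σ p T)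
    (hrich : ∃ U : Ω → ℝ, IsUniformRV P U) (hσ : IsDistortion σ) (hp : 1 < p) :
    Function.Surjective (NormedSpace.inclusionInDoubleDual 𝕂 E) := by
  intro Ψ
  have hp0 : 0 < p := by linarith
  have hex : ∀ Z : Ω → 𝕂, ∃ ψ : StrongDual 𝕂 E, BddMeas Z →
      ((∀ e, ψ e = ∫ ω, Z ω * T e ω ∂P) ∧ ∀ C : ℝ, (∀ ω, ‖Z ω‖ ≤ C) → ‖ψ‖ ≤ 3 * C) := by
    intro Z
    by_cases hZ : BddMeas Z
    · obtain ⟨ψ, hψ⟩ := h.exists_functional hrich hσ hp.le hZ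
      exact ⟨ψ, fun _ => hψ⟩
    · exact ⟨0, fun hZ' => absurd hZ' hZ⟩
  choose Φ hΦ' using hex
  have hΦ : ∀ Z, BddMeas Z → ∀ e, Φ Z e = ∫ ω, Z ω * T e ω ∂P := fun Z hZ => (hΦ' Z hZ).1
  have hint : ∀ {Z : Ω → 𝕂}, BddMeas Z → ∀ e, Integrable (fun ω => Z ω * T e ω) P :=
    fun hZ e => by simpa only [mul_comm] using hZ.integrable_mul (h.integrable hrich hσ hp.le e)
  have hΦadd : ∀ f g, BddMeas f → BddMeas g → Φ (f + g) = Φ f + Φ g := by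
    intro f g hf hg
    ext e
    rw [add_apply, hΦ _ (hf.add hg), hΦ _ hf, hΦ _ hg, ← integral_add (hint hf e) (hint hg e)]
    simp only [Pi.add_apply, add_mul]
  have hΦsmul : ∀ (c : 𝕂) f, BddMeas f → Φ (c • f) = c • Φ f := by
    intro c f hf
    ext e
    rw [smul_apply, hΦ _ (hf.const_smul c), hΦ _ hf, ← integral_smul]
    simp only [Pi.smul_apply, smul_eq_mul, mul_assoc]
  have hΦind : ∀ A : Set Ω, MeasurableSet A → ∀ e,
      Φ (A.indicator fun _ => 1) e = Φ (fun _ => 1) (cutLsigma P T A e) := by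
    intro A hA e
    rw [hΦ _ ((bddMeas_const 1).indicator hA), hΦ _ (bddMeas_const 1)]
    refine integral_congr_ae ?_
    filter_upwards [h.apply_cut hp0.le hA e] with ω hω
    rw [hω]
    by_cases hωA : ω ∈ A <;> simp [hωA]
  obtain ⟨Y, hYm, -, hY⟩ := exists_density_of_functional (P := P) (fun f => Ψ (Φ f))
    (fun f g hf hg => by rw [hΦadd f g hf hg, map_add])
    (fun c f hf => by rw [hΦsmul c f hf, map_smul, smul_eq_mul])
    (K := ‖Ψ‖ * 3) (fun f C hf hC => by
      rw [mul_assoc]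
      exact (Ψ.le_opNorm _).trans
        (mul_le_mul_of_nonneg_left ((hΦ' f ⟨hf, C, hC⟩).2 C hC) (norm_nonneg _)))
    (fun η hη => by
      have hK : 0 < ‖Ψ‖ + 1 := by positivity
      obtain ⟨δ, hδ, hcut⟩ :=
        h.exists_norm_apply_cut_le hrich hσ hp (Φ fun _ => 1) (div_pos hη hK)
      refine ⟨δ, hδ, fun A hA hPA => ?_⟩
      have h1 : ‖Φ (A.indicator fun _ => 1)‖ ≤ η / (‖Ψ‖ + 1) :=
        ContinuousLinearMap.opNorm_le_bound _ (by positivity) fun e => by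
          rw [hΦind A hA]
          exact hcut A hA hPA e
      calc _ ≤ ‖Ψ‖ * (η / (‖Ψ‖ + 1)) :=
            (Ψ.le_opNorm _).trans (mul_le_mul_of_nonneg_left h1 (norm_nonneg _))
        _ ≤ (‖Ψ‖ + 1) * (η / (‖Ψ‖ + 1)) := by
            gcongr
            linarith
        _ = η := mul_div_cancel₀ _ hK.ne')
  have hYmem : MemLsigma P σ p Y := by
    refine ⟨hYm.aestronglyMeasurable, lt_of_le_of_lt (iSup₂_le fun U hU => ?_)
      (ENNReal.ofReal_lt_top (r := 2 * ‖Ψ‖ * (2 * (‖Ψ‖ + 1)) ^ (p - 1)))⟩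
    exact h.lintegral_le_of_pairing hσ hp hΦ Ψ hYm hY hU
  obtain ⟨e, he⟩ := h.surj Y hYmem
  have hbdd : ∀ Z, BddMeas Z → Ψ (Φ Z) = Φ Z e := by
    intro Z hZ
    rw [hY Z hZ, hΦ Z hZ]
    refine integral_congr_ae ?_
    filter_upwards [he] with ω hω
    rw [hω, mul_comm]
  refine ⟨e, ContinuousLinearMap.ext fun φ => ?_⟩
  rw [NormedSpace.dual_def, eq_comm, ← sub_eq_zero, ← norm_le_zero_iff]
  refine le_of_forall_pos_le_add fun η hη => ?_
  have hK : 0 < ‖Ψ‖ + ‖e‖ + 1 := by positivity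
  obtain ⟨Z, hZ, hφ⟩ := h.exists_bddMeas_norm_sub_functional_le hrich hσ hp φ (div_pos hη hK)
  have h1 : Ψ φ - φ e = Ψ (φ - Φ Z) - (φ - Φ Z) e := by
    rw [map_sub, sub_apply, hbdd Z hZ]
    ring
  have h2 := hφ (Φ Z) (hΦ Z hZ)
  rw [h1, zero_add]
  calc _ ≤ ‖Ψ‖ * ‖φ - Φ Z‖ + ‖φ - Φ Z‖ * ‖e‖ :=
        (norm_sub_le _ _).trans (add_le_add (Ψ.le_opNorm _) ((φ - Φ Z).le_opNorm _))
    _ ≤ (‖Ψ‖ + ‖e‖ + 1) * ‖φ - Φ Z‖ := by nlinarith [norm_nonneg (φ - Φ Z)]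
    _ ≤ (‖Ψ‖ + ‖e‖ + 1) * (η / (‖Ψ‖ + ‖e‖ + 1)) := by gcongr
    _ = η := mul_div_cancel₀ _ hK.ne'

end RealizesLsigma

/-- For `p ∈ (1,∞)` the Banach space `L_σ^p(P)` is reflexive:
any Banach space `E` realizing `L_σ^p(P)` — i.e., linearly (up to a.e. equality)
and isometrically parametrizing exactly the elements of `L_σ^p(P)` — is reflexive,
that is, the canonical inclusion of `E` into its double dual is surjective. -/
theorem statement17
    (P : Measure Ω) [IsProbabilityMeasure P]
    (hrich : ∃ U : Ω → ℝ, IsUniformRV P U)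
    {𝕂 : Type*} [RCLike 𝕂]
    (σ : ℝ → ℝ) (hσ : IsDistortion σ) (p : ℝ) (hp : 1 < p)
    (E : Type*) [NormedAddCommGroup E] [NormedSpace 𝕂 E] [CompleteSpace E]
    (T : E → Ω → 𝕂)
    (hadd : ∀ e₁ e₂ : E, T (e₁ + e₂) =ᵐ[P] T e₁ + T e₂)
    (hsmul : ∀ (c : 𝕂) (e : E), T (c • e) =ᵐ[P] c • T e)
    (hmem : ∀ e : E, MemLsigma P σ p (T e))
    (hnorm : ∀ e : E, ENNReal.ofReal ‖e‖ = sigmaNorm P σ p (T e))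
    (hsurj : ∀ Y : Ω → 𝕂, MemLsigma P σ p Y → ∃ e : E, T e =ᵐ[P] Y) :
    Function.Surjective (NormedSpace.inclusionInDoubleDual 𝕂 E) := by
  have h : RealizesLsigma P σ p T := ⟨hadd, hsmul, hmem, hnorm, hsurj⟩
  exact h.surjective_inclusionInDoubleDual hrich hσ hp

end
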